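/- There exist entire functions ψ, φ : ℂ → ℂ (depending only on q, α and w, and independent of n) such that for every positive integer m there exist a constant C(m) > 0 and an integer N_m such that for every even integer n > N_m and every t ∈ ℂ with |t| ≤ q^{-m-1/2}: |(-1)^{n/2} q^{-(n/2)((n/2)-1)} P_n(q^{n/2} t) − ψ(t)| < C(m) q^n and |(-1)^{n/2} q^{(n/2)((n/2)-1+α)} γ_{n-1}^{-1} P_{n-1}(q^{n/2} t) − φ(t)| < C(m) q^n. -/

import Mathlib

open Polynomial


namespace QL

noncomputable def sg (b : Bool) : ℂ := if b then 1 else -1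

lemma sg_sq (b : Bool) : sg b ^ 2 = 1 := by cases b <;> simp [sg]
lemma sg_mul (b : Bool) : sg b * sg b = 1 := by cases b <;> simp [sg]
lemma norm_sg (b : Bool) : ‖sg b‖ = 1 := by cases b <;> simp [sg]
lemma conj_sg (b : Bool) : (starRingEnd ℂ) (sg b) = sg b := by cases b <;> simp [sg]

noncomputable def xi (q : ℝ) (j : ℕ × Bool) : ℂ := sg j.2 * ((q : ℂ)⁻¹) ^ (j.1 + 1)
noncomputable def eta (q : ℝ) (k : ℕ) (b : Bool) : ℂ := sg b * (q : ℂ) ^ k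

noncomputable def EE (q : ℝ) (N : ℕ) (t : ℂ) : ℂ :=
  ∏ i ∈ Finset.range N, (1 - (q : ℂ) ^ (2 * (i + 1)) * t ^ 2)
noncomputable def LL (q : ℝ) (N : ℕ) (j : ℕ × Bool) (t : ℂ) : ℂ :=
  -(sg j.2 * (q : ℂ) ^ (j.1 + 1)) * (1 + sg j.2 * (q : ℂ) ^ (j.1 + 1) * t) *
    ∏ i ∈ (Finset.range N).erase j.1, (1 - (q : ℂ) ^ (2 * (i + 1)) * t ^ 2)

lemma norm_eta_le {q : ℝ} (hq0 : 0 < q) (hq1 : q < 1) (k : ℕ) (b : Bool) : ‖eta q k b‖ ≤ 1 := by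
  rw [eta, norm_mul, norm_sg, one_mul, norm_pow, Complex.norm_real, Real.norm_of_nonneg hq0.le]
  exact pow_le_one₀ hq0.le hq1.le

lemma conj_eta (q : ℝ) (k : ℕ) (b : Bool) : (starRingEnd ℂ) (eta q k b) = eta q k b := by
  simp [eta, conj_sg]

lemma conj_LL (q : ℝ) (N : ℕ) (j : ℕ × Bool) (k : ℕ) (b : Bool) :
    (starRingEnd ℂ) (LL q N j (eta q k b)) = LL q N j (eta q k b) := by
  simp [LL, conj_eta, conj_sg]

/-- partial geometric sums -/
lemma sum_geo_le {q : ℝ} (hq0 : 0 < q) (hq1 : q < 1) (S : Finset ℕ) (N : ℕ)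
    (hS : ∀ i ∈ S, N ≤ i) :
    ∑ i ∈ S, q ^ (2 * (i + 1)) ≤ q ^ (2 * N) / (1 - q) := by
  have hs : Summable (fun i : ℕ => q ^ i) := summable_geometric_of_lt_one hq0.le hq1
  have h1 : ∑ i ∈ S, q ^ (2 * (i + 1)) ≤ ∑ i ∈ S, q ^ (2 * N) * q ^ (i - N) := by
    apply Finset.sum_le_sum
    intro i hi
    rw [← pow_add]
    apply pow_le_pow_of_le_one hq0.le hq1.le
    have := hS i hi
    omega
  refine h1.trans ?_
  rw [← Finset.mul_sum, div_eq_mul_inv, ← tsum_geometric_of_lt_one hq0.le hq1]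
  apply mul_le_mul_of_nonneg_left _ (by positivity)
  have h2 : ∑ i ∈ S, q ^ (i - N) = ∑ i ∈ S.image (fun i => i - N), q ^ i := by
    rw [Finset.sum_image]
    intro a ha b hb hab
    have := hS a ha
    have := hS b hb
    simp only at hab
    omega
  rw [h2]
  exact hs.sum_le_tsum _ (fun i _ => by positivity)

lemma prod_bd {q : ℝ} (hq0 : 0 < q) (hq1 : q < 1) (T : ℝ) (S : Finset ℕ)
    (t : ℂ) (ht : ‖t‖ ≤ T) :
    ‖∏ i ∈ S, (1 - (q : ℂ) ^ (2 * (i + 1)) * t ^ 2)‖ ≤ Real.exp (T ^ 2 / (1 - q)) := by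
  have h := Finset.norm_prod_one_add_sub_one_le S (fun i => -((q : ℂ) ^ (2 * (i + 1)) * t ^ 2))
  have hT : 0 ≤ T := (norm_nonneg t).trans ht
  have h3 : ∑ i ∈ S, ‖-((q : ℂ) ^ (2 * (i + 1)) * t ^ 2)‖ ≤ T ^ 2 / (1 - q) := by
    calc ∑ i ∈ S, ‖-((q : ℂ) ^ (2 * (i + 1)) * t ^ 2)‖ ≤ ∑ i ∈ S, q ^ (2 * (i + 1)) * T ^ 2 := by
          apply Finset.sum_le_sum
          intro i _
          rw [norm_neg, norm_mul, norm_pow, norm_pow, Complex.norm_real, Real.norm_of_nonneg hq0.le]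
          gcongr
      _ = (∑ i ∈ S, q ^ (2 * (i + 1))) * T ^ 2 := by rw [Finset.sum_mul]
      _ ≤ (q ^ (2 * 0) / (1 - q)) * T ^ 2 := by
          gcongr
          exact sum_geo_le hq0 hq1 S 0 (fun i _ => Nat.zero_le i)
      _ = T ^ 2 / (1 - q) := by simp; ring
  simp only [← sub_eq_add_neg] at h
  have h4 := norm_sub_norm_le (∏ i ∈ S, (1 - (q : ℂ) ^ (2 * (i + 1)) * t ^ 2)) 1
  have h5 := Real.exp_le_exp.2 h3
  rw [norm_one] at h4
  linarith

lemma exp_sub_one_le (x : ℝ) : Real.exp x - 1 ≤ x * Real.exp x := by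
  have h := Real.add_one_le_exp (-x)
  have h2 := Real.exp_pos x
  have h3 : Real.exp (-x) * Real.exp x = 1 := by rw [← Real.exp_add]; simp
  nlinarith

lemma prod_diff {q : ℝ} (hq0 : 0 < q) (hq1 : q < 1) (T : ℝ) (S : Finset ℕ) (N : ℕ)
    (hS : ∀ i ∈ S, N ≤ i) (t : ℂ) (ht : ‖t‖ ≤ T) :
    ‖∏ i ∈ S, (1 - (q : ℂ) ^ (2 * (i + 1)) * t ^ 2) - 1‖ ≤
      q ^ (2 * N) * (T ^ 2 / (1 - q) * Real.exp (T ^ 2 / (1 - q))) := by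
  have h := Finset.norm_prod_one_add_sub_one_le S (fun i => -((q : ℂ) ^ (2 * (i + 1)) * t ^ 2))
  have hT : 0 ≤ T := (norm_nonneg t).trans ht
  have h1q : 0 < 1 - q := by linarith
  have h3 : ∑ i ∈ S, ‖-((q : ℂ) ^ (2 * (i + 1)) * t ^ 2)‖ ≤ q ^ (2 * N) * (T ^ 2 / (1 - q)) := by
    calc ∑ i ∈ S, ‖-((q : ℂ) ^ (2 * (i + 1)) * t ^ 2)‖ ≤ ∑ i ∈ S, q ^ (2 * (i + 1)) * T ^ 2 := by
          apply Finset.sum_le_sum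
          intro i _
          rw [norm_neg, norm_mul, norm_pow, norm_pow, Complex.norm_real, Real.norm_of_nonneg hq0.le]
          gcongr
      _ = (∑ i ∈ S, q ^ (2 * (i + 1))) * T ^ 2 := by rw [Finset.sum_mul]
      _ ≤ (q ^ (2 * N) / (1 - q)) * T ^ 2 := by
          gcongr
          exact sum_geo_le hq0 hq1 S N hS
      _ = _ := by ring
  simp only [← sub_eq_add_neg] at h
  refine h.trans ?_
  refine (sub_le_sub_right (Real.exp_le_exp.2 h3) 1).trans ((exp_sub_one_le _).trans ?_)
  rw [mul_assoc]
  have hp : q ^ (2 * N) ≤ 1 := pow_le_one₀ hq0.le hq1.le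
  have h6 : 0 ≤ T ^ 2 / (1 - q) := by positivity
  gcongr
  exact mul_le_of_le_one_left h6 hp

lemma EE_LL_bounds {q : ℝ} (hq0 : 0 < q) (hq1 : q < 1) (T : ℝ) (hT : 0 ≤ T) :
    ∃ C : ℝ, 1 ≤ C ∧ ∀ N M : ℕ, N ≤ M → ∀ t : ℂ, ‖t‖ ≤ T →
      ‖EE q N t‖ ≤ C ∧ ‖EE q N t - EE q M t‖ ≤ C * q ^ (2 * N) ∧
      (∀ j, ‖LL q N j t‖ ≤ C) ∧
      (∀ j, j.1 < N → ‖LL q N j t - LL q M j t‖ ≤ C * q ^ (2 * N)) := by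
  have h1q : 0 < 1 - q := by linarith
  set B := Real.exp (T ^ 2 / (1 - q)) with hB
  set A := T ^ 2 / (1 - q) * B with hA
  have hB1 : 1 ≤ B := Real.one_le_exp (by positivity)
  have hA0 : 0 ≤ A := by positivity
  have hpre : ∀ (j : ℕ × Bool) (t : ℂ), ‖t‖ ≤ T →
      ‖-(sg j.2 * (q : ℂ) ^ (j.1 + 1)) * (1 + sg j.2 * (q : ℂ) ^ (j.1 + 1) * t)‖ ≤ 1 + T := by
    intro j t ht
    have h1 : ‖sg j.2 * (q : ℂ) ^ (j.1 + 1)‖ ≤ 1 := norm_eta_le hq0 hq1 (j.1 + 1) j.2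
    have h2 : ‖1 + sg j.2 * (q : ℂ) ^ (j.1 + 1) * t‖ ≤ 1 + T := by
      refine (norm_add_le _ _).trans ?_
      rw [norm_one, norm_mul]
      have := mul_le_mul h1 ht (norm_nonneg _) zero_le_one
      linarith
    rw [norm_mul, norm_neg]
    calc _ ≤ 1 * (1 + T) := mul_le_mul h1 h2 (norm_nonneg _) zero_le_one
      _ = _ := one_mul _
  have key : ∀ (S : Finset ℕ) (N M : ℕ) (t : ℂ), ‖t‖ ≤ T →
      ‖∏ i ∈ S, (1 - (q : ℂ) ^ (2 * (i + 1)) * t ^ 2) -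
        (∏ i ∈ S, (1 - (q : ℂ) ^ (2 * (i + 1)) * t ^ 2)) *
          ∏ i ∈ Finset.Ico N M, (1 - (q : ℂ) ^ (2 * (i + 1)) * t ^ 2)‖ ≤ (B * A) * q ^ (2 * N) := by
    intro S N M t ht
    have h1 := prod_bd hq0 hq1 T S t ht
    have h2 := prod_diff hq0 hq1 T (Finset.Ico N M) N (fun i hi => (Finset.mem_Ico.1 hi).1) t ht
    rw [← norm_neg, neg_sub, ← mul_sub_one, norm_mul]
    calc _ ≤ B * (q ^ (2 * N) * A) := mul_le_mul h1 h2 (norm_nonneg _) (by positivity)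
      _ = _ := by ring
  have hsplitE : ∀ N M : ℕ, N ≤ M → ∀ t, EE q M t = EE q N t *
      ∏ i ∈ Finset.Ico N M, (1 - (q : ℂ) ^ (2 * (i + 1)) * t ^ 2) := by
    intro N M h t
    rw [EE, EE, Finset.prod_range_mul_prod_Ico _ h]
  have hsplitL : ∀ N M : ℕ, N ≤ M → ∀ j : ℕ × Bool, j.1 < N → ∀ t : ℂ,
      ∏ i ∈ (Finset.range M).erase j.1, (1 - (q : ℂ) ^ (2 * (i + 1)) * t ^ 2) =
      (∏ i ∈ (Finset.range N).erase j.1, (1 - (q : ℂ) ^ (2 * (i + 1)) * t ^ 2)) *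
      ∏ i ∈ Finset.Ico N M, (1 - (q : ℂ) ^ (2 * (i + 1)) * t ^ 2) := by
    intro N M h j hj t
    rw [← Finset.prod_union]
    · congr 1
      ext i
      simp only [Finset.mem_erase, Finset.mem_range, Finset.mem_union, Finset.mem_Ico]
      omega
    · rw [Finset.disjoint_left]
      intro i
      simp only [Finset.mem_erase, Finset.mem_range, Finset.mem_Ico]
      omega
  refine ⟨(1 + T) * (B + B * A), ?_, ?_⟩
  · nlinarith [mul_nonneg (zero_le_one.trans hB1) hA0, mul_nonneg hT (mul_nonneg (zero_le_one.trans hB1) hA0)]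
  · intro N M hNM t ht
    have hBA : 0 ≤ B * A := by positivity
    have hqN : 0 ≤ q ^ (2 * N) := by positivity
    have hc1 : B ≤ (1 + T) * (B + B * A) := by nlinarith [mul_nonneg hT hBA]
    have hc2 : B * A ≤ (1 + T) * (B + B * A) := by nlinarith [mul_nonneg hT hBA]
    refine ⟨(prod_bd hq0 hq1 T _ t ht).trans hc1, ?_, ?_, ?_⟩
    · rw [hsplitE N M hNM]
      exact (key _ N M t ht).trans (mul_le_mul_of_nonneg_right hc2 hqN)
    · intro j
      rw [LL, norm_mul]
      calc _ ≤ (1 + T) * B := mul_le_mul (hpre j t ht) (prod_bd hq0 hq1 T _ t ht) (norm_nonneg _) (by positivity)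
        _ ≤ _ := by gcongr; linarith
    · intro j hj
      rw [LL, LL, hsplitL N M hNM j hj, ← mul_sub, norm_mul]
      calc _ ≤ (1 + T) * ((B * A) * q ^ (2 * N)) := mul_le_mul (hpre j t ht) (key _ N M t ht) (norm_nonneg _) (by positivity)
        _ = ((1 + T) * (B * A)) * q ^ (2 * N) := by ring
        _ ≤ _ := by gcongr; linarith

end QL


namespace QL

noncomputable def dd (q : ℝ) (N i : ℕ) : ℝ :=
  2 * q ^ (i + 1) * ∏ l ∈ (Finset.range N).erase i, (1 - q ^ (2 * (l + 1)) * ((q⁻¹) ^ (i + 1)) ^ 2)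

noncomputable def ee (q β : ℝ) (N i : ℕ) : ℝ := β ^ (i + 1) / (dd q N i) ^ 2

lemma LL_xi {q : ℝ} (hq0 : 0 < q) (N : ℕ) (j : ℕ × Bool) :
    LL q N j (xi q j) = -(sg j.2) * (dd q N j.1 : ℂ) := by
  have hq : (q : ℂ) ≠ 0 := by exact_mod_cast hq0.ne'
  have h1 : sg j.2 * (q : ℂ) ^ (j.1 + 1) * xi q j = 1 := by
    rw [xi]
    calc _ = (sg j.2 * sg j.2) * ((q : ℂ) ^ (j.1 + 1) * ((q : ℂ)⁻¹) ^ (j.1 + 1)) := by ring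
      _ = 1 := by rw [sg_mul, ← mul_pow, mul_inv_cancel₀ hq]; simp
  have h2 : xi q j ^ 2 = (((q : ℂ)⁻¹) ^ (j.1 + 1)) ^ 2 := by
    rw [xi, mul_pow, sg_sq, one_mul]
  rw [LL, h1, h2, dd]
  push_cast
  ring

lemma prod_lower {q : ℝ} (hq0 : 0 < q) (hq1 : q < 1) :
    ∃ c : ℝ, 0 < c ∧ c ≤ 1 ∧ ∀ n : ℕ, c ≤ ∏ m ∈ Finset.range n, (1 - q ^ (2 * (m + 1))) := by
  have h1q : 0 < 1 - q := by linarith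
  refine ⟨Real.exp (-(1 / (1 - q) / (1 - q))), Real.exp_pos _, ?_, ?_⟩
  · apply Real.exp_le_one_iff.2
    have : 0 ≤ 1 / (1 - q) / (1 - q) := by positivity
    linarith
  intro n
  have h1 : ∀ m : ℕ, Real.exp (-(q ^ (2 * (m + 1)) / (1 - q))) ≤ 1 - q ^ (2 * (m + 1)) := by
    intro m
    set x := q ^ (2 * (m + 1)) with hx
    have hx0 : 0 < x := by positivity
    have hxq : x ≤ q := by
      calc x ≤ q ^ 1 := pow_le_pow_of_le_one hq0.le hq1.le (by omega)
        _ = q := pow_one q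
    rw [Real.exp_neg]
    apply inv_le_of_inv_le₀ (by linarith)
    have h := Real.add_one_le_exp (x / (1 - q))
    refine le_trans ?_ h
    rw [inv_le_iff_one_le_mul₀ (by linarith)]
    have : x ≤ x / (1 - q) * (1 - x) := by
      rw [div_mul_eq_mul_div, le_div_iff₀ h1q]
      nlinarith
    linarith
  calc Real.exp (-(1 / (1 - q) / (1 - q)))
      ≤ Real.exp (∑ m ∈ Finset.range n, -(q ^ (2 * (m + 1)) / (1 - q))) := by
        apply Real.exp_le_exp.2
        rw [Finset.sum_neg_distrib, ← Finset.sum_div]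
        apply neg_le_neg
        have := sum_geo_le hq0 hq1 (Finset.range n) 0 (fun i _ => Nat.zero_le i)
        simp only [mul_zero, pow_zero] at this
        gcongr
    _ = ∏ m ∈ Finset.range n, Real.exp (-(q ^ (2 * (m + 1)) / (1 - q))) := Real.exp_sum _ _
    _ ≤ _ := Finset.prod_le_prod (fun i _ => (Real.exp_pos _).le) (fun i _ => h1 i)

lemma prod_pow_tri (q : ℝ) (i : ℕ) :
    ∏ m ∈ Finset.range i, (q⁻¹) ^ (2 * (m + 1)) = (q⁻¹) ^ (i * (i + 1)) := by
  induction i with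
  | zero => simp
  | succ n ih =>
    rw [Finset.prod_range_succ, ih, ← pow_add]
    congr 1
    ring

lemma dd_lower {q : ℝ} (hq0 : 0 < q) (hq1 : q < 1) :
    ∃ c : ℝ, 0 < c ∧ ∀ N i : ℕ, i < N → c * (q⁻¹) ^ (3 * (i + 1)) ≤ |dd q N i| := by
  obtain ⟨c, hc0, hc1, hc⟩ := prod_lower hq0 hq1
  refine ⟨q ^ 6 * c * c, by positivity, ?_⟩
  intro N i hi
  have hset : (Finset.range N).erase i = Finset.range i ∪ Finset.Ico (i + 1) N := by
    ext l
    simp only [Finset.mem_erase, Finset.mem_range, Finset.mem_union, Finset.mem_Ico]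
    omega
  have hdisj : Disjoint (Finset.range i) (Finset.Ico (i + 1) N) := by
    rw [Finset.disjoint_left]
    intro l
    simp only [Finset.mem_range, Finset.mem_Ico]
    omega
  have hqi : q⁻¹ * q = 1 := inv_mul_cancel₀ hq0.ne'
  have hcancel : ∀ n : ℕ, (q⁻¹) ^ n * q ^ n = 1 := fun n => by rw [← mul_pow, hqi, one_pow]
  have hA : c * (q⁻¹) ^ (i * (i + 1)) ≤
      |∏ l ∈ Finset.range i, (1 - q ^ (2 * (l + 1)) * ((q⁻¹) ^ (i + 1)) ^ 2)| := by
    rw [← Finset.prod_range_reflect, Finset.abs_prod]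
    have : ∀ m ∈ Finset.range i, |1 - q ^ (2 * (i - 1 - m + 1)) * ((q⁻¹) ^ (i + 1)) ^ 2| =
        (q⁻¹) ^ (2 * (m + 1)) * (1 - q ^ (2 * (m + 1))) := by
      intro m hm
      have hm' := Finset.mem_range.1 hm
      have e1 : q ^ (2 * (i - 1 - m + 1)) * ((q⁻¹) ^ (i + 1)) ^ 2 = (q⁻¹) ^ (2 * (m + 1)) := by
        have : ((q⁻¹) ^ (i + 1)) ^ 2 = (q⁻¹) ^ (2 * (i - 1 - m + 1)) * (q⁻¹) ^ (2 * (m + 1)) := by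
          rw [← pow_mul, ← pow_add]
          congr 1
          omega
        rw [this, ← mul_assoc, mul_comm (q ^ _), hcancel, one_mul]
      have e2 : 1 ≤ (q⁻¹) ^ (2 * (m + 1)) := one_le_pow₀ ((one_le_inv₀ hq0).2 hq1.le)
      rw [e1, abs_of_nonpos (by linarith), mul_sub, hcancel]
      ring
    rw [Finset.prod_congr rfl this, Finset.prod_mul_distrib, prod_pow_tri q, mul_comm]
    exact mul_le_mul_of_nonneg_left (hc i) (by positivity)
  have hB : c ≤ |∏ l ∈ Finset.Ico (i + 1) N, (1 - q ^ (2 * (l + 1)) * ((q⁻¹) ^ (i + 1)) ^ 2)| := by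
    rw [Finset.prod_Ico_eq_prod_range]
    refine le_trans ?_ (le_abs_self _)
    refine (hc (N - (i + 1))).trans (le_of_eq ?_)
    apply Finset.prod_congr rfl
    intro m _
    have : q ^ (2 * (i + 1 + m + 1)) = q ^ (2 * (m + 1)) * (q ^ (2 * (i + 1))) := by
      rw [← pow_add]; congr 1; ring
    rw [this, ← pow_mul, mul_comm (i + 1) 2, mul_assoc, mul_comm (q ^ (2 * (i + 1))), hcancel, mul_one]
  rw [dd, hset, Finset.prod_union hdisj, abs_mul, abs_of_pos (by positivity : 0 < 2 * q ^ (i + 1)), abs_mul]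
  have hC : q ^ 6 * (q⁻¹) ^ (3 * (i + 1)) ≤ q ^ (i + 1) * (q⁻¹) ^ (i * (i + 1)) := by
    have e1 : q ^ (6 + i * (i + 1)) ≤ q ^ ((i + 1) + 3 * (i + 1)) := by
      apply pow_le_pow_of_le_one hq0.le hq1.le
      zify
      nlinarith [sq_nonneg ((i : ℤ) - 1), sq_nonneg ((i : ℤ) - 2), mul_self_nonneg ((2 : ℤ) * i - 3), Int.le_self_sq ((i:ℤ) - 1)]
    rw [pow_add, pow_add] at e1
    have p1 : 0 < (q⁻¹) ^ (3 * (i + 1)) := by positivity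
    have p2 : 0 < (q⁻¹) ^ (i * (i + 1)) := by positivity
    calc q ^ 6 * (q⁻¹) ^ (3 * (i + 1))
        = (q ^ 6 * q ^ (i * (i + 1))) * ((q⁻¹) ^ (3 * (i + 1)) * (q⁻¹) ^ (i * (i + 1))) := by
          linear_combination (-(q ^ 6 * (q⁻¹) ^ (3 * (i + 1)))) * hcancel (i * (i + 1))
      _ ≤ (q ^ (i + 1) * q ^ (3 * (i + 1))) * ((q⁻¹) ^ (3 * (i + 1)) * (q⁻¹) ^ (i * (i + 1))) := by gcongr
      _ = _ := by
          linear_combination ((q ^ (i + 1) * (q⁻¹) ^ (i * (i + 1)))) * hcancel (3 * (i + 1))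
  calc q ^ 6 * c * c * (q⁻¹) ^ (3 * (i + 1)) = (q ^ 6 * (q⁻¹) ^ (3 * (i + 1))) * (c * c) := by ring
    _ ≤ (q ^ (i + 1) * (q⁻¹) ^ (i * (i + 1))) * (c * c) := by gcongr
    _ ≤ 2 * (q ^ (i + 1) * (q⁻¹) ^ (i * (i + 1)) * (c * c)) := by
        have : 0 ≤ q ^ (i + 1) * (q⁻¹) ^ (i * (i + 1)) * (c * c) := by positivity
        linarith
    _ = 2 * q ^ (i + 1) * ((c * (q⁻¹) ^ (i * (i + 1))) * c) := by ring
    _ ≤ _ := by gcongr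

lemma dd_ne {q : ℝ} (hq0 : 0 < q) (hq1 : q < 1) (N i : ℕ) (hi : i < N) : dd q N i ≠ 0 := by
  obtain ⟨c, hc0, hc⟩ := dd_lower hq0 hq1
  have := hc N i hi
  have h2 : 0 < c * (q⁻¹) ^ (3 * (i + 1)) := by positivity
  exact abs_pos.1 (h2.trans_le this)

lemma ee_pos {q β : ℝ} (hq0 : 0 < q) (hq1 : q < 1) (hβ0 : 0 < β) (N i : ℕ) (hi : i < N) :
    0 < ee q β N i := by
  have := dd_ne hq0 hq1 N i hi
  rw [ee]
  positivity

lemma ee_upper {q β : ℝ} (hq0 : 0 < q) (hq1 : q < 1) (hβ0 : 0 < β) (hβ1 : β < 1) :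
    ∃ C : ℝ, 1 ≤ C ∧ ∀ N i : ℕ, i < N → ee q β N i ≤ C * q ^ (6 * (i + 1)) := by
  obtain ⟨c, hc0, hc⟩ := dd_lower hq0 hq1
  refine ⟨max 1 (c⁻¹ ^ 2), le_max_left _ _, ?_⟩
  intro N i hi
  have h1 := hc N i hi
  have hd := dd_ne hq0 hq1 N i hi
  have h2 : (c * (q⁻¹) ^ (3 * (i + 1))) ^ 2 ≤ dd q N i ^ 2 := by
    rw [← sq_abs (dd q N i)]
    gcongr
  have h3 : β ^ (i + 1) ≤ 1 := pow_le_one₀ hβ0.le hβ1.le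
  calc ee q β N i ≤ 1 / (c * (q⁻¹) ^ (3 * (i + 1))) ^ 2 := by
        rw [ee]
        gcongr
    _ = c⁻¹ ^ 2 * q ^ (6 * (i + 1)) := by
        have e : q ^ (6 * (i + 1)) = (q ^ (3 * (i + 1))) ^ 2 := by
          rw [← pow_mul]; congr 1; ring
        rw [e, inv_pow q]
        field_simp
    _ ≤ _ := by
        gcongr
        exact le_max_right _ _

lemma one_sub_sum_le_prod' (S : Finset ℕ) (x : ℕ → ℝ) (h0 : ∀ i ∈ S, 0 ≤ x i) (h1 : ∀ i ∈ S, x i ≤ 1) :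
    1 - ∑ i ∈ S, x i ≤ ∏ i ∈ S, (1 - x i) ∧ 0 ≤ ∏ i ∈ S, (1 - x i) ∧ ∏ i ∈ S, (1 - x i) ≤ 1 := by
  induction S using Finset.induction_on with
  | empty => simp
  | insert a S ha ih =>
    obtain ⟨i1, i2, i3⟩ := ih (fun i hi => h0 i (Finset.mem_insert_of_mem hi))
      (fun i hi => h1 i (Finset.mem_insert_of_mem hi))
    have g0 := h0 a (Finset.mem_insert_self a S)
    have g1 := h1 a (Finset.mem_insert_self a S)
    rw [Finset.sum_insert ha, Finset.prod_insert ha]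
    refine ⟨?_, ?_, ?_⟩
    · nlinarith
    · apply mul_nonneg <;> linarith
    · nlinarith

lemma dd_ratio {q : ℝ} (hq0 : 0 < q) (hq1 : q < 1) (N M i : ℕ) (hi : i < N) (hNM : N ≤ M) :
    ∃ π : ℝ, dd q M i = dd q N i * π ∧ 0 ≤ π ∧ π ≤ 1 ∧
      1 - π ≤ q ^ (2 * N) * (q⁻¹) ^ (2 * (i + 1)) / (1 - q) := by
  have h1q : 0 < 1 - q := by linarith
  have hqi : q⁻¹ * q = 1 := inv_mul_cancel₀ hq0.ne'
  have hcancel : ∀ n : ℕ, (q⁻¹) ^ n * q ^ n = 1 := fun n => by rw [← mul_pow, hqi, one_pow]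
  have hx1 : ∀ l ∈ Finset.Ico N M, q ^ (2 * (l + 1)) * ((q⁻¹) ^ (i + 1)) ^ 2 ≤ 1 := by
    intro l hl
    have := (Finset.mem_Ico.1 hl).1
    have h := hcancel (2 * (i + 1))
    rw [← pow_mul, mul_comm (i + 1) 2, ← h, mul_comm]
    apply mul_le_mul_of_nonneg_left _ (by positivity)
    apply pow_le_pow_of_le_one hq0.le hq1.le
    omega
  obtain ⟨a1, a2, a3⟩ := one_sub_sum_le_prod' (Finset.Ico N M)
    (fun l => q ^ (2 * (l + 1)) * ((q⁻¹) ^ (i + 1)) ^ 2) (fun l _ => by positivity) hx1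
  refine ⟨∏ l ∈ Finset.Ico N M, (1 - q ^ (2 * (l + 1)) * ((q⁻¹) ^ (i + 1)) ^ 2), ?_, a2, a3, ?_⟩
  · rw [dd, dd, mul_assoc _ (∏ l ∈ (Finset.range N).erase i, _), ← Finset.prod_union]
    · congr 2
      ext l
      simp only [Finset.mem_erase, Finset.mem_range, Finset.mem_union, Finset.mem_Ico]
      omega
    · rw [Finset.disjoint_left]
      intro l
      simp only [Finset.mem_erase, Finset.mem_range, Finset.mem_Ico]
      omega
  · have h2 : ∑ l ∈ Finset.Ico N M, q ^ (2 * (l + 1)) * ((q⁻¹) ^ (i + 1)) ^ 2 ≤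
        q ^ (2 * N) / (1 - q) * ((q⁻¹) ^ (i + 1)) ^ 2 := by
      rw [← Finset.sum_mul]
      gcongr
      exact sum_geo_le hq0 hq1 _ N (fun l hl => (Finset.mem_Ico.1 hl).1)
    have h3 : q ^ (2 * N) / (1 - q) * ((q⁻¹) ^ (i + 1)) ^ 2 =
        q ^ (2 * N) * (q⁻¹) ^ (2 * (i + 1)) / (1 - q) := by
      rw [← pow_mul, mul_comm (i + 1) 2]; ring
    linarith

/-- the relative difference of diagonal weights -/
lemma ee_ratio {q β : ℝ} (hq0 : 0 < q) (hq1 : q < 1) (hβ0 : 0 < β)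
    (N M i : ℕ) (hi : i < N) (hNM : N ≤ M) :
    |ee q β N i / ee q β M i - 1| ≤ 2 / (1 - q) * (q ^ (2 * N) * (q⁻¹) ^ (2 * (i + 1))) := by
  obtain ⟨π, h1, h2, h3, h4⟩ := dd_ratio hq0 hq1 N M i hi hNM
  have hd := dd_ne hq0 hq1 N i hi
  have hM := dd_ne hq0 hq1 M i (hi.trans_le hNM)
  have : ee q β N i / ee q β M i = π ^ 2 := by
    rw [ee, ee]
    have hβ : β ^ (i + 1) ≠ 0 := by positivity
    rw [div_div_div_cancel_left' _ _ hβ, h1]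
    field_simp
  rw [this, abs_of_nonpos (by nlinarith)]
  have : 2 / (1 - q) * (q ^ (2 * N) * (q⁻¹) ^ (2 * (i + 1))) =
      2 * (q ^ (2 * N) * (q⁻¹) ^ (2 * (i + 1)) / (1 - q)) := by ring
  rw [this]
  nlinarith

end QL


namespace QL

def JJ (N : ℕ) : Finset (ℕ × Bool) := Finset.range N ×ˢ Finset.univ

lemma mem_JJ {N : ℕ} {j : ℕ × Bool} : j ∈ JJ N ↔ j.1 < N := by simp [JJ]

noncomputable def Lam (β q : ℝ) (v : ℕ → Bool → ℂ) (f : ℂ → ℂ) : ℂ :=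
  ∑' k : ℕ, ∑ b : Bool, f (eta q k b) * v k b * (β : ℂ) ^ k

lemma Lam_term_bd {β q : ℝ} (hβ0 : 0 < β) {v : ℕ → Bool → ℂ} {f : ℂ → ℂ} {A : ℝ}
    (h : ∀ k b, ‖f (eta q k b) * v k b‖ ≤ A) (k : ℕ) :
    ‖∑ b : Bool, f (eta q k b) * v k b * (β : ℂ) ^ k‖ ≤ 2 * A * β ^ k := by
  rw [← Finset.sum_mul, norm_mul, norm_pow, Complex.norm_real, Real.norm_of_nonneg hβ0.le]
  gcongr
  rw [Fintype.sum_bool]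
  refine (norm_add_le _ _).trans ?_
  linarith [h k true, h k false]

lemma Lam_summable {β q : ℝ} (hβ0 : 0 < β) (hβ1 : β < 1) {v : ℕ → Bool → ℂ} {f : ℂ → ℂ} {A : ℝ}
    (h : ∀ k b, ‖f (eta q k b) * v k b‖ ≤ A) :
    Summable (fun k : ℕ => ∑ b : Bool, f (eta q k b) * v k b * (β : ℂ) ^ k) :=
  Summable.of_norm_bounded ((summable_geometric_of_lt_one hβ0.le hβ1).mul_left (2 * A))
    (Lam_term_bd hβ0 h)

lemma Lam_bd {β q : ℝ} (hβ0 : 0 < β) (hβ1 : β < 1) {v : ℕ → Bool → ℂ} {f : ℂ → ℂ} {A : ℝ}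
    (h : ∀ k b, ‖f (eta q k b) * v k b‖ ≤ A) :
    ‖Lam β q v f‖ ≤ 2 / (1 - β) * A := by
  have hs := (hasSum_geometric_of_lt_one hβ0.le hβ1).mul_left (2 * A)
  have := tsum_of_norm_bounded hs (Lam_term_bd hβ0 h)
  refine this.trans (le_of_eq ?_)
  ring

lemma Lam_diff {β q : ℝ} (hβ0 : 0 < β) (hβ1 : β < 1) {v : ℕ → Bool → ℂ} {f g : ℂ → ℂ} {A δ ε : ℝ}
    (hA : ∀ k b, ‖f (eta q k b)‖ ≤ A) (hv : ∀ k b, ‖v k b - 1‖ ≤ ε)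
    (hd : ∀ k b, ‖f (eta q k b) - g (eta q k b)‖ ≤ δ) :
    ‖Lam β q v f - Lam β q (fun _ _ => 1) g‖ ≤ 2 / (1 - β) * (A * ε + δ) := by
  have hA0 : 0 ≤ A := (norm_nonneg _).trans (hA 0 true)
  have h1 : ∀ k b, ‖f (eta q k b) * v k b‖ ≤ A * (1 + ε) := by
    intro k b
    rw [norm_mul]
    apply mul_le_mul (hA k b) _ (norm_nonneg _) hA0
    have := norm_add_le 1 (v k b - 1)
    rw [norm_one] at this
    have e : 1 + (v k b - 1) = v k b := by ring
    rw [e] at this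
    linarith [hv k b]
  have h2 : ∀ k b, ‖g (eta q k b) * (fun (_ : ℕ) (_ : Bool) => (1 : ℂ)) k b‖ ≤ A + δ := by
    intro k b
    rw [mul_one]
    have := norm_sub_le (f (eta q k b)) (f (eta q k b) - g (eta q k b))
    rw [sub_sub_cancel] at this
    linarith [hA k b, hd k b]
  have e : Lam β q v f - Lam β q (fun _ _ => 1) g =
      ∑' k : ℕ, ∑ b : Bool, (f (eta q k b) * (v k b - 1) + (f (eta q k b) - g (eta q k b))) * (β : ℂ) ^ k := by
    rw [Lam, Lam, ← (Lam_summable hβ0 hβ1 h1).tsum_sub (Lam_summable hβ0 hβ1 h2)]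
    congr 1
    ext k
    rw [← Finset.sum_sub_distrib]
    apply Finset.sum_congr rfl
    intro b _
    ring
  rw [e]
  have hs := (hasSum_geometric_of_lt_one hβ0.le hβ1).mul_left (2 * (A * ε + δ))
  refine (tsum_of_norm_bounded hs ?_).trans (le_of_eq (by ring))
  intro k
  rw [← Finset.sum_mul, norm_mul, norm_pow, Complex.norm_real, Real.norm_of_nonneg hβ0.le]
  gcongr
  have hb : ∀ b, ‖f (eta q k b) * (v k b - 1) + (f (eta q k b) - g (eta q k b))‖ ≤ A * ε + δ := by
    intro b
    refine (norm_add_le _ _).trans (add_le_add ?_ (hd k b))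
    rw [norm_mul]
    exact mul_le_mul (hA k b) (hv k b) (norm_nonneg _) hA0
  rw [Fintype.sum_bool]
  refine (norm_add_le _ _).trans ?_
  linarith [hb true, hb false]

lemma energy {q β : ℝ} (hq0 : 0 < q) (hq1 : q < 1) (hβ0 : 0 < β) (hβ1 : β < 1) (M : ℕ)
    (a R : ℕ × Bool → ℂ)
    (h : ∀ j ∈ JJ M, a j / (ee q β M j.1 : ℂ) +
      Lam β q (fun _ _ => 1) (fun t => (∑ i ∈ JJ M, a i * LL q M i t) * LL q M j t) = R j) :
    ∑ j ∈ JJ M, ‖a j‖ ^ 2 / ee q β M j.1 ≤ ∑ j ∈ JJ M, ee q β M j.1 * ‖R j‖ ^ 2 := by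
  obtain ⟨C, hC1, hC⟩ := EE_LL_bounds hq0 hq1 1 zero_le_one
  have hL : ∀ j k b, ‖LL q M j (eta q k b)‖ ≤ C := fun j k b =>
    (hC M M le_rfl _ (norm_eta_le hq0 hq1 k b)).2.2.1 j
  obtain ⟨G, hG⟩ : ∃ G : ℂ → ℂ, ∀ t, G t = ∑ i ∈ JJ M, a i * LL q M i t := ⟨_, fun t => rfl⟩
  simp only [← hG] at h
  have hGb : ∀ k b, ‖G (eta q k b)‖ ≤ (∑ i ∈ JJ M, ‖a i‖ * C) := by
    intro k b
    rw [hG]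
    refine (norm_sum_le _ _).trans (Finset.sum_le_sum fun i _ => ?_)
    rw [norm_mul]
    exact mul_le_mul_of_nonneg_left (hL i k b) (norm_nonneg _)
  have hS : ∀ j, Summable (fun k : ℕ => ∑ b : Bool, (fun t => G t * LL q M j t) (eta q k b) *
      (fun (_ : ℕ) (_ : Bool) => (1 : ℂ)) k b * (β : ℂ) ^ k) := by
    intro j
    refine Lam_summable (v := fun _ _ => 1) (f := fun t => G t * LL q M j t) hβ0 hβ1
      (A := (∑ i ∈ JJ M, ‖a i‖ * C) * C) ?_
    intro k b
    rw [mul_one, norm_mul]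
    exact mul_le_mul (hGb k b) (hL j k b) (norm_nonneg _) ((norm_nonneg _).trans (hGb k b))
  have hquad : ∑ j ∈ JJ M, (starRingEnd ℂ) (a j) *
      Lam β q (fun _ _ => 1) (fun t => G t * LL q M j t) =
      ((∑' k : ℕ, ∑ b : Bool, ‖G (eta q k b)‖ ^ 2 * β ^ k : ℝ) : ℂ) := by
    simp only [Lam]
    simp_rw [← tsum_mul_left]
    rw [← Summable.tsum_finsetSum (fun j _ => (hS j).mul_left _), Complex.ofReal_tsum]
    congr 1
    ext k
    push_cast
    simp_rw [Finset.mul_sum]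
    rw [Finset.sum_comm]
    apply Finset.sum_congr rfl
    intro b _
    rw [← Complex.conj_mul' (G (eta q k b))]
    have : (starRingEnd ℂ) (G (eta q k b)) = ∑ j ∈ JJ M, (starRingEnd ℂ) (a j) * LL q M j (eta q k b) := by
      simp only [hG, map_sum, map_mul, conj_LL]
    rw [this, Finset.sum_mul, Finset.sum_mul]
    apply Finset.sum_congr rfl
    intro j _
    ring
  have hsum : ∑ j ∈ JJ M, (starRingEnd ℂ) (a j) * R j =
      ((∑ j ∈ JJ M, ‖a j‖ ^ 2 / ee q β M j.1 +
        ∑' k : ℕ, ∑ b : Bool, ‖G (eta q k b)‖ ^ 2 * β ^ k : ℝ) : ℂ) := by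
    rw [Complex.ofReal_add, ← hquad, Complex.ofReal_sum, ← Finset.sum_add_distrib]
    apply Finset.sum_congr rfl
    intro j hj
    rw [← h j hj]
    push_cast
    rw [← Complex.conj_mul' (a j)]
    ring
  have hnn : 0 ≤ ∑' k : ℕ, ∑ b : Bool, ‖G (eta q k b)‖ ^ 2 * β ^ k :=
    tsum_nonneg fun k => Finset.sum_nonneg fun b _ => by positivity
  have h1 : ∑ j ∈ JJ M, ‖a j‖ ^ 2 / ee q β M j.1 ≤ ‖∑ j ∈ JJ M, (starRingEnd ℂ) (a j) * R j‖ := by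
    rw [hsum, Complex.norm_real]
    refine le_trans ?_ (le_abs_self _)
    linarith
  have h2 : ‖∑ j ∈ JJ M, (starRingEnd ℂ) (a j) * R j‖ ≤
      ∑ j ∈ JJ M, (‖a j‖ ^ 2 / ee q β M j.1 + ee q β M j.1 * ‖R j‖ ^ 2) / 2 := by
    refine (norm_sum_le _ _).trans (Finset.sum_le_sum fun j hj => ?_)
    have he := ee_pos hq0 hq1 hβ0 M j.1 (mem_JJ.1 hj)
    rw [norm_mul, RCLike.norm_conj]
    set e := ee q β M j.1
    have : ‖a j‖ ^ 2 / e + e * ‖R j‖ ^ 2 - 2 * (‖a j‖ * ‖R j‖) = (‖a j‖ - e * ‖R j‖) ^ 2 / e := by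
      field_simp
      ring
    have h3 : 0 ≤ (‖a j‖ - e * ‖R j‖) ^ 2 / e := by positivity
    linarith
  rw [← Finset.sum_div, Finset.sum_add_distrib] at h2
  linarith

lemma sum_JJ_geo {q : ℝ} (hq0 : 0 < q) (hq1 : q < 1) (M : ℕ) :
    ∑ j ∈ JJ M, q ^ (2 * (j.1 + 1)) ≤ 2 / (1 - q) := by
  rw [JJ, Finset.sum_product]
  simp only [Finset.sum_const, Finset.card_univ, Fintype.card_bool, nsmul_eq_mul]
  rw [← Finset.mul_sum]
  have := sum_geo_le hq0 hq1 (Finset.range M) 0 (fun i _ => Nat.zero_le i)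
  simp only [mul_zero, pow_zero] at this
  calc _ ≤ (2 : ℕ) * (1 / (1 - q)) := by gcongr
    _ = _ := by push_cast; ring

lemma energy_bound {q β : ℝ} (hq0 : 0 < q) (hq1 : q < 1) (hβ0 : 0 < β) (hβ1 : β < 1) :
    ∃ C : ℝ, 1 ≤ C ∧ ∀ (M : ℕ) (a R : ℕ × Bool → ℂ) (B : ℝ), 0 ≤ B →
    (∀ j ∈ JJ M, a j / (ee q β M j.1 : ℂ) +
      Lam β q (fun _ _ => 1) (fun t => (∑ i ∈ JJ M, a i * LL q M i t) * LL q M j t) = R j) →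
    (∀ j ∈ JJ M, ‖R j‖ ≤ B * (q⁻¹) ^ (2 * (j.1 + 1))) →
    ∑ j ∈ JJ M, ‖a j‖ ≤ C * B := by
  obtain ⟨D, hD1, hD⟩ := ee_upper hq0 hq1 hβ0 hβ1
  have h1q : 0 < 1 - q := by linarith
  have hK : 1 ≤ 2 / (1 - q) := by rw [le_div_iff₀ h1q]; linarith
  set K := 2 / (1 - q) with hKdef
  have hqi : q⁻¹ * q = 1 := inv_mul_cancel₀ hq0.ne'
  have hcancel : ∀ n : ℕ, (q⁻¹) ^ n * q ^ n = 1 := fun n => by rw [← mul_pow, hqi, one_pow]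
  refine ⟨D * K * K, by nlinarith [mul_le_mul hD1 hK zero_le_one (by linarith)], ?_⟩
  intro M a R B hB h hR
  have hen := energy hq0 hq1 hβ0 hβ1 M a R h
  have h2 : ∑ j ∈ JJ M, ee q β M j.1 * ‖R j‖ ^ 2 ≤ D * B ^ 2 * K := by
    calc _ ≤ ∑ j ∈ JJ M, (D * B ^ 2) * q ^ (2 * (j.1 + 1)) := by
          apply Finset.sum_le_sum
          intro j hj
          have he := hD M j.1 (mem_JJ.1 hj)
          have hr := hR j hj
          calc ee q β M j.1 * ‖R j‖ ^ 2 ≤ (D * q ^ (6 * (j.1 + 1))) * (B * (q⁻¹) ^ (2 * (j.1 + 1))) ^ 2 := by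
                gcongr
            _ = (D * B ^ 2) * q ^ (2 * (j.1 + 1)) := by
                have e1 : q ^ (6 * (j.1 + 1)) = (q ^ (2 * (j.1 + 1))) ^ 3 := by
                  rw [← pow_mul]; congr 1; ring
                rw [e1]
                have := hcancel (2 * (j.1 + 1))
                set x := q ^ (2 * (j.1 + 1))
                set y := (q⁻¹) ^ (2 * (j.1 + 1))
                linear_combination D * B ^ 2 * x * (y * x + 1) * this
      _ = (D * B ^ 2) * ∑ j ∈ JJ M, q ^ (2 * (j.1 + 1)) := by rw [Finset.mul_sum]
      _ ≤ _ := by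
          gcongr
          exact sum_JJ_geo hq0 hq1 M
  have h3 : ∀ j ∈ JJ M, ‖a j‖ ≤ D * B * K * q ^ (2 * (j.1 + 1)) := by
    intro j hj
    have he := hD M j.1 (mem_JJ.1 hj)
    have hep := ee_pos hq0 hq1 hβ0 M j.1 (mem_JJ.1 hj)
    have h4 : ‖a j‖ ^ 2 / ee q β M j.1 ≤ D * B ^ 2 * K := by
      refine le_trans ?_ (hen.trans h2)
      exact Finset.single_le_sum (f := fun j => ‖a j‖ ^ 2 / ee q β M j.1)
        (fun i hi => div_nonneg (sq_nonneg _) (ee_pos hq0 hq1 hβ0 M i.1 (mem_JJ.1 hi)).le) hj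
    rw [div_le_iff₀ hep] at h4
    have h5 : ‖a j‖ ^ 2 ≤ (D * B * K * q ^ (2 * (j.1 + 1))) ^ 2 := by
      calc ‖a j‖ ^ 2 ≤ D * B ^ 2 * K * (D * q ^ (6 * (j.1 + 1))) :=
            h4.trans (mul_le_mul_of_nonneg_left he (by positivity))
        _ ≤ D * B ^ 2 * K * (D * (q ^ (2 * (j.1 + 1))) ^ 2) := by
            gcongr
            rw [← pow_mul]
            exact pow_le_pow_of_le_one hq0.le hq1.le (by omega)
        _ = (D ^ 2 * B ^ 2 * (q ^ (2 * (j.1 + 1))) ^ 2) * K := by ring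
        _ ≤ (D ^ 2 * B ^ 2 * (q ^ (2 * (j.1 + 1))) ^ 2) * K ^ 2 := by
            gcongr
            nlinarith
        _ = _ := by ring
    exact (le_abs_self _).trans (abs_le_of_sq_le_sq h5 (by positivity))
  calc _ ≤ ∑ j ∈ JJ M, D * B * K * q ^ (2 * (j.1 + 1)) := Finset.sum_le_sum h3
    _ = D * B * K * ∑ j ∈ JJ M, q ^ (2 * (j.1 + 1)) := by rw [Finset.mul_sum]
    _ ≤ D * B * K * K := by
        gcongr
        exact sum_JJ_geo hq0 hq1 M
    _ = _ := by ring

end QL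


namespace QL

noncomputable def FF (q : ℝ) (N : ℕ) (h : ℂ) (a : ℕ × Bool → ℂ) (t : ℂ) : ℂ :=
  h * EE q N t + ∑ i ∈ JJ N, a i * LL q N i t

lemma JJ_mono {N M : ℕ} (h : N ≤ M) : JJ N ⊆ JJ M := by
  intro j hj
  rw [mem_JJ] at *
  omega

lemma FF_bounds {q : ℝ} (hq0 : 0 < q) (hq1 : q < 1) (T : ℝ) (hT : 0 ≤ T) :
    ∃ C : ℝ, 1 ≤ C ∧ ∀ N M : ℕ, N ≤ M → ∀ t : ℂ, ‖t‖ ≤ T →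
      (∀ j, ‖LL q N j t‖ ≤ C) ∧
      (∀ j, j.1 < N → ‖LL q N j t - LL q M j t‖ ≤ C * q ^ (2 * N)) ∧
      ∀ (h : ℂ) (a : ℕ × Bool → ℂ), (∀ j, j ∉ JJ N → a j = 0) →
      ‖FF q N h a t‖ ≤ C * (‖h‖ + ∑ j ∈ JJ N, ‖a j‖) ∧
      ‖FF q M h a t‖ ≤ C * (‖h‖ + ∑ j ∈ JJ N, ‖a j‖) ∧
      ‖FF q N h a t - FF q M h a t‖ ≤ C * q ^ (2 * N) * (‖h‖ + ∑ j ∈ JJ N, ‖a j‖) := by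
  obtain ⟨C, hC1, hC⟩ := EE_LL_bounds hq0 hq1 T hT
  refine ⟨C, hC1, ?_⟩
  intro N M hNM t ht
  obtain ⟨c1, c2, c3, c4⟩ := hC N M hNM t ht
  obtain ⟨d1, -, d3, -⟩ := hC M M le_rfl t ht
  refine ⟨c3, c4, ?_⟩
  intro h a ha
  have hM : FF q M h a t = h * EE q M t + ∑ i ∈ JJ N, a i * LL q M i t := by
    rw [FF]
    congr 1
    symm
    apply Finset.sum_subset (JJ_mono hNM)
    intro j _ hj
    rw [ha j hj, zero_mul]
  have gen : ∀ (X : ℂ) (Y : ℕ × Bool → ℂ) (D : ℝ), ‖X‖ ≤ D → (∀ j ∈ JJ N, ‖Y j‖ ≤ D) →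
      ‖h * X + ∑ i ∈ JJ N, a i * Y i‖ ≤ D * (‖h‖ + ∑ j ∈ JJ N, ‖a j‖) := by
    intro X Y D hX hY
    refine (norm_add_le _ _).trans ?_
    rw [mul_add, Finset.mul_sum]
    refine add_le_add ?_ ((norm_sum_le _ _).trans (Finset.sum_le_sum fun j hj => ?_))
    · rw [norm_mul, mul_comm]
      gcongr
    · rw [norm_mul, mul_comm]
      have := hY j hj
      gcongr
  refine ⟨gen _ _ _ c1 (fun j _ => c3 j), ?_, ?_⟩
  · rw [hM]
    exact gen _ _ _ d1 (fun j _ => d3 j)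
  · have : FF q N h a t - FF q M h a t =
        h * (EE q N t - EE q M t) + ∑ i ∈ JJ N, a i * (LL q N i t - LL q M i t) := by
      rw [hM, FF]
      simp only [mul_sub, Finset.sum_sub_distrib]
      ring
    rw [this]
    exact gen _ _ _ c2 (fun j hj => c4 j (mem_JJ.1 hj))

structure Sys (q β : ℝ) (v : ℕ → Bool → ℂ) (N : ℕ) (h κ : ℂ) (a : ℕ × Bool → ℂ) : Prop where
  supp : ∀ j, j ∉ JJ N → a j = 0
  eqn : ∀ j ∈ JJ N, a j / (ee q β N j.1 : ℂ) * v (N - (j.1 + 1)) j.2 +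
    Lam β q (fun k b => v (N + k) b) (fun t => FF q N h a t * LL q N j t) = κ

lemma residual {q β : ℝ} (hq0 : 0 < q) (hq1 : q < 1) (hβ0 : 0 < β) (hβ1 : β < 1)
    (v : ℕ → Bool → ℂ) (c : ℝ) (hc : 0 ≤ c) (hvne : ∀ k b, v k b ≠ 0)
    (hv : ∀ k b, ‖v k b - 1‖ ≤ c * q ^ (2 * k))
    (hv' : ∀ k b, ‖(v k b)⁻¹ - 1‖ ≤ c * q ^ (2 * k)) (h κ : ℂ) :
    ∃ C : ℝ, 1 ≤ C ∧ ∀ N M : ℕ, N ≤ M → ∀ a, Sys q β v N h κ a → ∀ j ∈ JJ M,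
      ‖a j / (ee q β M j.1 : ℂ) +
        Lam β q (fun _ _ => 1) (fun t => FF q M h a t * LL q M j t) - κ‖ ≤
      C * (q ^ (2 * N) * (1 + ∑ j ∈ JJ N, ‖a j‖)) * (q⁻¹) ^ (2 * (j.1 + 1)) := by
  obtain ⟨C0, hC1, hC⟩ := FF_bounds hq0 hq1 1 zero_le_one
  have h1q : 0 < 1 - q := by linarith
  have h1β : 0 < 1 - β := by linarith
  obtain ⟨K, hK⟩ : ∃ K, K = 2 / (1 - β) := ⟨_, rfl⟩
  obtain ⟨K1, hK1⟩ : ∃ K, K = 2 / (1 - q) := ⟨_, rfl⟩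
  have hK0 : 0 < K := by rw [hK]; positivity
  have hK10 : 0 < K1 := by rw [hK1]; positivity
  have hqi : q⁻¹ * q = 1 := inv_mul_cancel₀ hq0.ne'
  have hcancel : ∀ n : ℕ, (q⁻¹) ^ n * q ^ n = 1 := fun n => by rw [← mul_pow, hqi, one_pow]
  -- constants
  obtain ⟨H, hH⟩ : ∃ H, H = 1 + ‖h‖ + ‖κ‖ := ⟨_, rfl⟩
  have hH1 : 1 ≤ H := by rw [hH]; linarith [norm_nonneg h, norm_nonneg κ]
  obtain ⟨Y, hY⟩ : ∃ Y, Y = 1 + K * C0 ^ 2 * (1 + c) := ⟨_, rfl⟩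
  have hY1 : 1 ≤ Y := by rw [hY]; have : 0 ≤ K * C0 ^ 2 * (1 + c) := by positivity
                         linarith
  obtain ⟨Z, hZ⟩ : ∃ Z, Z = K * (C0 ^ 2 * c + 2 * C0 ^ 2) := ⟨_, rfl⟩
  have hZ0 : 0 ≤ Z := by rw [hZ]; positivity
  refine ⟨Y * H + (K1 * (1 + c) + c) * (Y * H) + Z * H, ?_, ?_⟩
  · have h1 : 1 ≤ Y * H := by nlinarith
    have h2 : 0 ≤ (K1 * (1 + c) + c) * (Y * H) := by positivity
    have h3 : 0 ≤ Z * H := by positivity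
    linarith
  intro N M hNM a ha j hj
  have hS0 : 0 ≤ ∑ j ∈ JJ N, ‖a j‖ := Finset.sum_nonneg fun _ _ => norm_nonneg _
  obtain ⟨S, hS⟩ : ∃ S, S = ∑ j ∈ JJ N, ‖a j‖ := ⟨_, rfl⟩
  rw [← hS] at hS0 ⊢
  have hfb : ∀ k b, ‖FF q N h a (eta q k b)‖ ≤ C0 * (‖h‖ + S) := fun k b => by
    rw [hS]; exact ((hC N M hNM _ (norm_eta_le hq0 hq1 k b)).2.2 h a ha.supp).1
  have hgb : ∀ k b, ‖FF q M h a (eta q k b)‖ ≤ C0 * (‖h‖ + S) := fun k b => by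
    rw [hS]; exact ((hC N M hNM _ (norm_eta_le hq0 hq1 k b)).2.2 h a ha.supp).2.1
  have hfg : ∀ k b, ‖FF q N h a (eta q k b) - FF q M h a (eta q k b)‖ ≤
      C0 * q ^ (2 * N) * (‖h‖ + S) := fun k b => by
    rw [hS]; exact ((hC N M hNM _ (norm_eta_le hq0 hq1 k b)).2.2 h a ha.supp).2.2
  have hLN : ∀ k b, ‖LL q N j (eta q k b)‖ ≤ C0 := fun k b =>
    (hC N M hNM _ (norm_eta_le hq0 hq1 k b)).1 j
  have hLM : ∀ k b, ‖LL q M j (eta q k b)‖ ≤ C0 := fun k b =>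
    (hC M M le_rfl _ (norm_eta_le hq0 hq1 k b)).1 j
  obtain ⟨Λ0, hΛ0⟩ : ∃ x, x = Lam β q (fun _ _ => 1) (fun t => FF q M h a t * LL q M j t) := ⟨_, rfl⟩
  rw [← hΛ0]
  have hB0 : 0 ≤ ‖h‖ + S := by positivity
  have hBH : ‖h‖ + S ≤ H * (1 + S) := by rw [hH]; nlinarith [norm_nonneg h, norm_nonneg κ, mul_nonneg (norm_nonneg h) hS0, mul_nonneg (norm_nonneg κ) hS0]
  have hκH : ‖κ‖ + (‖h‖ + S) ≤ H * (1 + S) := by rw [hH]; nlinarith [norm_nonneg h, norm_nonneg κ, mul_nonneg (norm_nonneg h) hS0, mul_nonneg (norm_nonneg κ) hS0]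
  -- the size of Λ - κ
  have hYbd : ∀ x : ℂ, ‖x‖ ≤ K * (C0 ^ 2 * (‖h‖ + S) * (1 + c)) → ‖κ - x‖ ≤ Y * H * (1 + S) := by
    intro x hx
    refine (norm_sub_le _ _).trans ?_
    have : ‖κ‖ + ‖x‖ ≤ Y * (‖κ‖ + (‖h‖ + S)) := by
      have e : Y * (‖κ‖ + (‖h‖ + S)) = ‖κ‖ + (‖h‖ + S) + K * C0 ^ 2 * (1 + c) * ‖κ‖ + K * (C0 ^ 2 * (‖h‖ + S) * (1 + c)) := by
        rw [hY]; ring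
      have : 0 ≤ K * C0 ^ 2 * (1 + c) * ‖κ‖ := by positivity
      linarith
    refine this.trans ?_
    rw [mul_assoc]
    gcongr
  have hX0 : 0 ≤ q ^ (2 * N) * (q⁻¹) ^ (2 * (j.1 + 1)) := by positivity
  have hS1 : 0 ≤ 1 + S := by linarith
  have hYH : 0 ≤ Y * H := by positivity
  have hZH : 0 ≤ Z * H := by positivity
  have hW : 0 ≤ (K1 * (1 + c) + c) * (Y * H) := by positivity
  by_cases hjN : j.1 < N
  · have hjmem := mem_JJ.2 hjN
    have heq := ha.eqn j hjmem
    obtain ⟨ΛN, hΛN⟩ : ∃ x, x = Lam β q (fun k b => v (N + k) b) (fun t => FF q N h a t * LL q N j t) := ⟨_, rfl⟩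
    rw [← hΛN] at heq
    have hvN : ∀ k b, ‖v (N + k) b - 1‖ ≤ c * q ^ (2 * N) := fun k b =>
      (hv (N + k) b).trans (mul_le_mul_of_nonneg_left
        (pow_le_pow_of_le_one hq0.le hq1.le (by omega)) hc)
    have hqN1 : q ^ (2 * N) ≤ 1 := pow_le_one₀ hq0.le hq1.le
    have hff : ∀ k b, ‖FF q N h a (eta q k b) * LL q N j (eta q k b)‖ ≤ C0 ^ 2 * (‖h‖ + S) := by
      intro k b
      rw [norm_mul]
      calc _ ≤ (C0 * (‖h‖ + S)) * C0 := mul_le_mul (hfb k b) (hLN k b) (norm_nonneg _) (by positivity)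
        _ = _ := by ring
    have hdiff : ‖ΛN - Λ0‖ ≤ Z * q ^ (2 * N) * (‖h‖ + S) := by
      have := Lam_diff (β := β) (q := q) (v := fun k b => v (N + k) b)
        (f := fun t => FF q N h a t * LL q N j t) (g := fun t => FF q M h a t * LL q M j t)
        (A := C0 ^ 2 * (‖h‖ + S)) (δ := 2 * C0 ^ 2 * q ^ (2 * N) * (‖h‖ + S)) (ε := c * q ^ (2 * N))
        hβ0 hβ1 hff hvN ?_
      · rw [← hΛN, ← hΛ0, ← hK] at this
        refine this.trans (le_of_eq ?_)
        rw [hZ]; ring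
      · intro k b
        have e : FF q N h a (eta q k b) * LL q N j (eta q k b) - FF q M h a (eta q k b) * LL q M j (eta q k b) =
          (FF q N h a (eta q k b) - FF q M h a (eta q k b)) * LL q N j (eta q k b) +
            FF q M h a (eta q k b) * (LL q N j (eta q k b) - LL q M j (eta q k b)) := by ring
        rw [e]
        refine (norm_add_le _ _).trans ?_
        rw [norm_mul, norm_mul]
        have hl := (hC N M hNM _ (norm_eta_le hq0 hq1 k b)).2.1 j hjN
        calc _ ≤ (C0 * q ^ (2 * N) * (‖h‖ + S)) * C0 + (C0 * (‖h‖ + S)) * (C0 * q ^ (2 * N)) :=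
              add_le_add (mul_le_mul (hfg k b) (hLN k b) (norm_nonneg _) (by positivity))
                (mul_le_mul (hgb k b) hl (norm_nonneg _) (by positivity))
          _ = _ := by ring
    have hΛNb : ‖ΛN‖ ≤ K * (C0 ^ 2 * (‖h‖ + S) * (1 + c)) := by
      rw [hΛN, hK]
      apply Lam_bd hβ0 hβ1
      intro k b
      rw [norm_mul]
      refine mul_le_mul (hff k b) ?_ (norm_nonneg _) (by positivity)
      have h1 := norm_add_le 1 (v (N + k) b - 1)
      have e : 1 + (v (N + k) b - 1) = v (N + k) b := by ring
      rw [e, norm_one] at h1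
      have h2 := hvN k b
      have h3 : c * q ^ (2 * N) ≤ c := mul_le_of_le_one_right hc hqN1
      linarith
    have hκΛ := hYbd ΛN hΛNb
    -- the diagonal
    obtain ⟨X, hX⟩ : ∃ X, X = q ^ (2 * N) * (q⁻¹) ^ (2 * (j.1 + 1)) := ⟨_, rfl⟩
    have hXeq : q ^ (2 * (N - (j.1 + 1))) = X := by
      have : q ^ (2 * N) = q ^ (2 * (N - (j.1 + 1))) * q ^ (2 * (j.1 + 1)) := by
        rw [← pow_add]; congr 1; omega
      rw [hX, this, mul_assoc, mul_comm (q ^ (2 * (j.1 + 1))), hcancel, mul_one]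
    have hu := ee_ratio hq0 hq1 hβ0 N M j.1 hjN hNM
    rw [← hX, ← hK1] at hu
    have hvi := hv' (N - (j.1 + 1)) j.2
    rw [hXeq] at hvi
    have hXle : X ≤ 1 := by rw [← hXeq]; exact pow_le_one₀ hq0.le hq1.le
    have hXnn : 0 ≤ X := by rw [hX]; exact hX0
    obtain ⟨V, hV⟩ : ∃ V, V = v (N - (j.1 + 1)) j.2 := ⟨_, rfl⟩
    have hVne : V ≠ 0 := by rw [hV]; exact hvne _ _
    rw [← hV] at heq hvi
    have heN := (ee_pos hq0 hq1 hβ0 N j.1 hjN).ne'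
    have heM := (ee_pos hq0 hq1 hβ0 M j.1 (hjN.trans_le hNM)).ne'
    obtain ⟨u, hudef⟩ : ∃ u : ℝ, u = ee q β N j.1 / ee q β M j.1 := ⟨_, rfl⟩
    rw [← hudef] at hu
    have haj : a j / (ee q β M j.1 : ℂ) = (u : ℂ) * V⁻¹ * (κ - ΛN) := by
      have heN' : (ee q β N j.1 : ℂ) ≠ 0 := by exact_mod_cast heN
      have heM' : (ee q β M j.1 : ℂ) ≠ 0 := by exact_mod_cast heM
      rw [← heq, hudef]
      push_cast
      field_simp
      ring
    have hr : a j / (ee q β M j.1 : ℂ) + Λ0 - κ = ((u : ℂ) * V⁻¹ - 1) * (κ - ΛN) - (ΛN - Λ0) := by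
      rw [haj]; ring
    have huV : ‖(u : ℂ) * V⁻¹ - 1‖ ≤ (K1 * (1 + c) + c) * X := by
      have e : (u : ℂ) * V⁻¹ - 1 = ((u - 1 : ℝ) : ℂ) * V⁻¹ + (V⁻¹ - 1) := by push_cast; ring
      rw [e]
      refine (norm_add_le _ _).trans ?_
      rw [norm_mul, Complex.norm_real, Real.norm_eq_abs]
      have h1 := norm_add_le 1 (V⁻¹ - 1)
      have e1 : 1 + (V⁻¹ - 1) = V⁻¹ := by ring
      rw [e1, norm_one] at h1
      have h3 : c * X ≤ c := mul_le_of_le_one_right hc hXle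
      have h4 : ‖V⁻¹‖ ≤ 1 + c := by linarith
      have h5 := mul_le_mul hu h4 (norm_nonneg _) (by positivity)
      nlinarith
    have hq2 : (1 : ℝ) ≤ (q⁻¹) ^ (2 * (j.1 + 1)) := one_le_pow₀ ((one_le_inv₀ hq0).2 hq1.le)
    rw [hr]
    refine (norm_sub_le _ _).trans ?_
    rw [norm_mul]
    have t1 : ‖(u : ℂ) * V⁻¹ - 1‖ * ‖κ - ΛN‖ ≤ ((K1 * (1 + c) + c) * X) * (Y * H * (1 + S)) :=
      mul_le_mul huV hκΛ (norm_nonneg _) (by positivity)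
    have hqX : q ^ (2 * N) ≤ X := by rw [hX]; exact le_mul_of_one_le_right (by positivity) hq2
    have t2 : Z * q ^ (2 * N) * (‖h‖ + S) ≤ Z * X * (H * (1 + S)) := by gcongr
    calc _ ≤ ((K1 * (1 + c) + c) * X) * (Y * H * (1 + S)) + Z * X * (H * (1 + S)) := by linarith
      _ ≤ (Y * H + (K1 * (1 + c) + c) * (Y * H) + Z * H) * (X * (1 + S)) := by
          have : 0 ≤ Y * H * (X * (1 + S)) := by positivity
          linarith
      _ = _ := by rw [hX]; ring
  · have ha0 : a j = 0 := ha.supp j (fun hh => hjN (mem_JJ.1 hh))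
    have hX1 : 1 ≤ q ^ (2 * N) * (q⁻¹) ^ (2 * (j.1 + 1)) := by
      rw [← hcancel (2 * (j.1 + 1)), mul_comm]
      apply mul_le_mul_of_nonneg_right _ (by positivity)
      exact pow_le_pow_of_le_one hq0.le hq1.le (by omega)
    have hΛb : ‖Λ0‖ ≤ K * (C0 ^ 2 * (‖h‖ + S) * (1 + c)) := by
      rw [hΛ0, hK]
      apply Lam_bd hβ0 hβ1
      intro k b
      rw [mul_one, norm_mul]
      calc _ ≤ (C0 * (‖h‖ + S)) * C0 := mul_le_mul (hgb k b) (hLM k b) (norm_nonneg _) (by positivity)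
        _ = C0 ^ 2 * (‖h‖ + S) * 1 := by ring
        _ ≤ _ := by gcongr; linarith
    rw [ha0, zero_div, zero_add, norm_sub_rev]
    refine (hYbd Λ0 hΛb).trans ?_
    calc Y * H * (1 + S) = Y * H * (1 + S) * 1 := by ring
      _ ≤ (Y * H + (K1 * (1 + c) + c) * (Y * H) + Z * H) * (1 + S) * (q ^ (2 * N) * (q⁻¹) ^ (2 * (j.1 + 1))) := by
          gcongr
          linarith
      _ = _ := by ring

lemma FF_linear {q : ℝ} (N : ℕ) (h : ℂ) (a : ℕ × Bool → ℂ) (t : ℂ) :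
    FF q N h a t = h * EE q N t + ∑ i ∈ JJ N, a i * LL q N i t := rfl

lemma Lam_add' {β q : ℝ} (hβ0 : 0 < β) (hβ1 : β < 1) {f g : ℂ → ℂ} {A B : ℝ} (x : ℂ)
    (hf : ∀ k b, ‖f (eta q k b)‖ ≤ A) (hg : ∀ k b, ‖g (eta q k b)‖ ≤ B) :
    Lam β q (fun _ _ => 1) (fun t => f t + x * g t) =
    Lam β q (fun _ _ => 1) f + x * Lam β q (fun _ _ => 1) g := by
  have h1 := Lam_summable (v := fun _ _ => 1) (f := f) (q := q) hβ0 hβ1 (A := A)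
    (fun k b => by rw [mul_one]; exact hf k b)
  have h2 := Lam_summable (v := fun _ _ => 1) (f := g) (q := q) hβ0 hβ1 (A := B)
    (fun k b => by rw [mul_one]; exact hg k b)
  rw [Lam, Lam, Lam, ← tsum_mul_left, ← h1.tsum_add (h2.mul_left x)]
  congr 1
  ext k
  rw [Finset.mul_sum, ← Finset.sum_add_distrib]
  apply Finset.sum_congr rfl
  intro b _
  ring

end QL


namespace QL

lemma S_bound {q β : ℝ} (hq0 : 0 < q) (hq1 : q < 1) (hβ0 : 0 < β) (hβ1 : β < 1)
    (v : ℕ → Bool → ℂ) (c : ℝ) (hc : 0 ≤ c) (hvne : ∀ k b, v k b ≠ 0)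
    (hv : ∀ k b, ‖v k b - 1‖ ≤ c * q ^ (2 * k))
    (hv' : ∀ k b, ‖(v k b)⁻¹ - 1‖ ≤ c * q ^ (2 * k)) (h κ : ℂ) :
    ∃ (N0 : ℕ) (S0 : ℝ), 0 ≤ S0 ∧ ∀ N, N0 ≤ N → ∀ a, Sys q β v N h κ a →
      ∑ j ∈ JJ N, ‖a j‖ ≤ S0 := by
  obtain ⟨C, hC1, hC⟩ := residual hq0 hq1 hβ0 hβ1 v c hc hvne hv hv' h κ
  obtain ⟨C1, hC11, hen⟩ := energy_bound hq0 hq1 hβ0 hβ1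
  obtain ⟨C0, hC01, hC0⟩ := EE_LL_bounds hq0 hq1 1 zero_le_one
  have h1β : 0 < 1 - β := by linarith
  obtain ⟨D, hD⟩ : ∃ D, D = ‖κ‖ + ‖h‖ * (2 / (1 - β) * (C0 * C0)) := ⟨_, rfl⟩
  have hD0 : 0 ≤ D := by rw [hD]; positivity
  have hCC : 0 < C1 * C := by positivity
  have hlim : ∃ N0 : ℕ, q ^ N0 < 1 / (2 * (C1 * C)) :=
    exists_pow_lt_of_lt_one (by positivity) hq1
  obtain ⟨N0, hN0⟩ := hlim
  refine ⟨N0, 1 + 2 * (C1 * D), by positivity, ?_⟩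
  intro N hN a ha
  obtain ⟨S, hS⟩ : ∃ S, S = ∑ j ∈ JJ N, ‖a j‖ := ⟨_, rfl⟩
  have hS0 : 0 ≤ S := by rw [hS]; exact Finset.sum_nonneg fun _ _ => norm_nonneg _
  have hres := hC N N le_rfl a ha
  rw [← hS] at hres ⊢
  have hEL : ∀ j k b, ‖EE q N (eta q k b) * LL q N j (eta q k b)‖ ≤ C0 * C0 := by
    intro j k b
    obtain ⟨e1, -, e3, -⟩ := hC0 N N le_rfl _ (norm_eta_le hq0 hq1 k b)
    rw [norm_mul]
    exact mul_le_mul e1 (e3 j) (norm_nonneg _) (by linarith)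
  have hGL : ∀ j k b, ‖(∑ i ∈ JJ N, a i * LL q N i (eta q k b)) * LL q N j (eta q k b)‖ ≤ (S * C0) * C0 := by
    intro j k b
    obtain ⟨e1, -, e3, -⟩ := hC0 N N le_rfl _ (norm_eta_le hq0 hq1 k b)
    rw [norm_mul]
    refine mul_le_mul ?_ (e3 j) (norm_nonneg _) (by positivity)
    rw [hS, Finset.sum_mul]
    refine (norm_sum_le _ _).trans (Finset.sum_le_sum fun i _ => ?_)
    rw [norm_mul]
    exact mul_le_mul_of_nonneg_left (e3 i) (norm_nonneg _)
  have hsplit : ∀ j, Lam β q (fun _ _ => 1) (fun t => FF q N h a t * LL q N j t) =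
      Lam β q (fun _ _ => 1) (fun t => (∑ i ∈ JJ N, a i * LL q N i t) * LL q N j t) +
      h * Lam β q (fun _ _ => 1) (fun t => EE q N t * LL q N j t) := by
    intro j
    rw [← Lam_add' hβ0 hβ1 h (hGL j) (hEL j)]
    congr 1
    ext t
    rw [FF]
    ring
  have hfin := hen N a (fun j => a j / (ee q β N j.1 : ℂ) +
      Lam β q (fun _ _ => 1) (fun t => (∑ i ∈ JJ N, a i * LL q N i t) * LL q N j t))
      (C * (q ^ (2 * N) * (1 + S)) + D) (by positivity) (fun j _ => rfl) ?_
  · rw [← hS] at hfin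
    have h1 : q ^ (2 * N) ≤ 1 / (2 * (C1 * C)) :=
      (pow_le_pow_of_le_one hq0.le hq1.le (by omega)).trans hN0.le
    rw [le_div_iff₀ (by positivity)] at h1
    have h2 : C1 * C * q ^ (2 * N) ≤ 1 / 2 := by linarith
    have h3 : C1 * C * q ^ (2 * N) * (1 + S) ≤ 1 / 2 * (1 + S) := by gcongr
    nlinarith
  · intro j hj
    have hr := hres j hj
    rw [hsplit j] at hr
    have hE : ‖Lam β q (fun _ _ => 1) (fun t => EE q N t * LL q N j t)‖ ≤ 2 / (1 - β) * (C0 * C0) := by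
      apply Lam_bd hβ0 hβ1
      intro k b
      rw [mul_one]
      exact hEL j k b
    have hq2 : (1 : ℝ) ≤ (q⁻¹) ^ (2 * (j.1 + 1)) := one_le_pow₀ ((one_le_inv₀ hq0).2 hq1.le)
    set r := a j / (ee q β N j.1 : ℂ)
    set L1 := Lam β q (fun _ _ => 1) (fun t => (∑ i ∈ JJ N, a i * LL q N i t) * LL q N j t)
    set L2 := Lam β q (fun _ _ => 1) (fun t => EE q N t * LL q N j t)
    have e : r + L1 = (r + (L1 + h * L2) - κ) + (κ - h * L2) := by ring
    have hb : ‖κ - h * L2‖ ≤ D := by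
      refine (norm_sub_le _ _).trans ?_
      rw [norm_mul, hD]
      gcongr
    rw [e, add_mul]
    refine (norm_add_le _ _).trans (add_le_add hr (hb.trans ?_))
    exact le_mul_of_one_le_right hD0 hq2

lemma sys_cauchy {q β : ℝ} (hq0 : 0 < q) (hq1 : q < 1) (hβ0 : 0 < β) (hβ1 : β < 1)
    (v : ℕ → Bool → ℂ) (c : ℝ) (hc : 0 ≤ c) (hvne : ∀ k b, v k b ≠ 0)
    (hv : ∀ k b, ‖v k b - 1‖ ≤ c * q ^ (2 * k))
    (hv' : ∀ k b, ‖(v k b)⁻¹ - 1‖ ≤ c * q ^ (2 * k)) (h κ : ℂ) :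
    ∃ N0 : ℕ, ∀ T : ℝ, 0 ≤ T → ∃ C : ℝ, 0 < C ∧ ∀ N M, N0 ≤ N → N ≤ M →
      ∀ a a', Sys q β v N h κ a → Sys q β v M h κ a' → ∀ t : ℂ, ‖t‖ ≤ T →
      ‖FF q N h a t - FF q M h a' t‖ ≤ C * q ^ (2 * N) := by
  obtain ⟨N0, S0, hS0, hS⟩ := S_bound hq0 hq1 hβ0 hβ1 v c hc hvne hv hv' h κ
  obtain ⟨C, hC1, hC⟩ := residual hq0 hq1 hβ0 hβ1 v c hc hvne hv hv' h κ
  obtain ⟨C1, hC11, hen⟩ := energy_bound hq0 hq1 hβ0 hβ1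
  obtain ⟨C2, hC21, hC2⟩ := FF_bounds hq0 hq1 1 zero_le_one
  refine ⟨N0, ?_⟩
  intro T hT
  obtain ⟨C0, hC01, hC0⟩ := FF_bounds hq0 hq1 T hT
  refine ⟨C0 * (‖h‖ + S0) + C0 * (C1 * (2 * (C * (1 + S0)))), by positivity, ?_⟩
  intro N M hN hNM a a' ha ha' t ht
  have hSa := hS N hN a ha
  have hSa' := hS M (hN.trans hNM) a' ha'
  have hFFd : ∀ t, FF q M h a t - FF q M h a' t = ∑ i ∈ JJ M, (a i - a' i) * LL q M i t := by
    intro t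
    rw [FF, FF]
    simp only [sub_mul, Finset.sum_sub_distrib]
    ring
  have hd : ∑ j ∈ JJ M, ‖a j - a' j‖ ≤ C1 * ((2 * (C * (1 + S0))) * q ^ (2 * N)) := by
    apply hen M (fun j => a j - a' j) (fun j => (a j - a' j) / (ee q β M j.1 : ℂ) +
      Lam β q (fun _ _ => 1) (fun t => (∑ i ∈ JJ M, (a i - a' i) * LL q M i t) * LL q M j t))
      _ (by positivity) (fun j _ => rfl)
    intro j hj
    have r1 := hC N M hNM a ha j hj
    have r2 := hC M M le_rfl a' ha' j hj
    have hf : ∀ k b, ‖FF q M h a (eta q k b) * LL q M j (eta q k b)‖ ≤ C2 * (‖h‖ + S0) * C2 := by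
      intro k b
      rw [norm_mul]
      obtain ⟨-, -, e⟩ := hC2 N M hNM _ (norm_eta_le hq0 hq1 k b)
      obtain ⟨e2, -, -⟩ := hC2 M M le_rfl _ (norm_eta_le hq0 hq1 k b)
      refine mul_le_mul ((e h a ha.supp).2.1.trans ?_) (e2 j) (norm_nonneg _) (by positivity)
      gcongr
    have hf' : ∀ k b, ‖FF q M h a' (eta q k b) * LL q M j (eta q k b)‖ ≤ C2 * (‖h‖ + S0) * C2 := by
      intro k b
      rw [norm_mul]
      obtain ⟨e2, -, e⟩ := hC2 M M le_rfl _ (norm_eta_le hq0 hq1 k b)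
      refine mul_le_mul ((e h a' ha'.supp).2.1.trans ?_) (e2 j) (norm_nonneg _) (by positivity)
      gcongr
    have hL := Lam_add' (f := fun t => FF q M h a t * LL q M j t)
      (g := fun t => FF q M h a' t * LL q M j t) hβ0 hβ1 (-1) hf hf'
    have e1 : (fun t => FF q M h a t * LL q M j t + (-1) * (FF q M h a' t * LL q M j t)) =
        (fun t => (∑ i ∈ JJ M, (a i - a' i) * LL q M i t) * LL q M j t) := by
      ext t
      rw [← hFFd t]
      ring
    rw [e1] at hL
    rw [hL]
    set L1 := Lam β q (fun _ _ => 1) (fun t => FF q M h a t * LL q M j t)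
    set L2 := Lam β q (fun _ _ => 1) (fun t => FF q M h a' t * LL q M j t)
    have e2 : (a j - a' j) / (ee q β M j.1 : ℂ) + (L1 + -1 * L2) =
      (a j / (ee q β M j.1 : ℂ) + L1 - κ) - (a' j / (ee q β M j.1 : ℂ) + L2 - κ) := by ring
    rw [e2]
    refine (norm_sub_le _ _).trans ((add_le_add r1 r2).trans ?_)
    rw [← add_mul]
    apply mul_le_mul_of_nonneg_right _ (by positivity)
    have hqq : q ^ (2 * M) ≤ q ^ (2 * N) := pow_le_pow_of_le_one hq0.le hq1.le (by omega)
    have hn : 0 ≤ ∑ j ∈ JJ M, ‖a' j‖ := Finset.sum_nonneg fun _ _ => norm_nonneg _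
    have hn' : 0 ≤ ∑ j ∈ JJ N, ‖a j‖ := Finset.sum_nonneg fun _ _ => norm_nonneg _
    calc _ ≤ C * (q ^ (2 * N) * (1 + S0)) + C * (q ^ (2 * N) * (1 + S0)) := by gcongr
      _ = _ := by ring
  obtain ⟨-, -, e⟩ := hC0 N M hNM t ht
  have e3 := (e h a ha.supp).2.2
  obtain ⟨g1, -, -⟩ := hC0 M M le_rfl t ht
  have e4 : FF q N h a t - FF q M h a' t = (FF q N h a t - FF q M h a t) +
      ∑ i ∈ JJ M, (a i - a' i) * LL q M i t := by
    rw [← hFFd t]; ring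
  rw [e4]
  refine (norm_add_le _ _).trans ?_
  have e5 : ‖∑ i ∈ JJ M, (a i - a' i) * LL q M i t‖ ≤ C0 * (C1 * ((2 * (C * (1 + S0))) * q ^ (2 * N))) := by
    refine (norm_sum_le _ _).trans (le_trans ?_ (mul_le_mul_of_nonneg_left hd (by positivity)))
    rw [Finset.mul_sum]
    apply Finset.sum_le_sum
    intro i _
    rw [norm_mul, mul_comm]
    exact mul_le_mul_of_nonneg_right (g1 i) (norm_nonneg _)
  have e6 : C0 * q ^ (2 * N) * (‖h‖ + ∑ j ∈ JJ N, ‖a j‖) ≤ C0 * q ^ (2 * N) * (‖h‖ + S0) := by gcongr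
  calc _ ≤ C0 * q ^ (2 * N) * (‖h‖ + S0) + C0 * (C1 * ((2 * (C * (1 + S0))) * q ^ (2 * N))) := by linarith
    _ = _ := by ring

lemma limit_entire {q : ℝ} (hq0 : 0 < q) (hq1 : q < 1) (f : ℕ → ℂ → ℂ) (hf : ∀ N, Differentiable ℂ (f N))
    (N0 : ℕ) (h : ∀ T : ℝ, 0 ≤ T → ∃ C : ℝ, 0 < C ∧ ∀ N M, N0 ≤ N → N ≤ M →
      ∀ t : ℂ, ‖t‖ ≤ T → ‖f N t - f M t‖ ≤ C * q ^ (2 * N)) :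
    ∃ ψ : ℂ → ℂ, Differentiable ℂ ψ ∧ ∀ T : ℝ, 0 ≤ T → ∃ C : ℝ, 0 < C ∧ ∀ N, N0 ≤ N →
      ∀ t : ℂ, ‖t‖ ≤ T → ‖f N t - ψ t‖ ≤ C * q ^ (2 * N) := by
  have hq2 : Filter.Tendsto (fun N : ℕ => q ^ (2 * N)) Filter.atTop (nhds 0) := by
    simp_rw [pow_mul]
    exact tendsto_pow_atTop_nhds_zero_of_lt_one (by positivity) (pow_lt_one₀ hq0.le hq1 two_ne_zero)
  have hlim : ∀ t : ℂ, ∃ y, Filter.Tendsto (fun N => f N t) Filter.atTop (nhds y) := by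
    intro t
    obtain ⟨C, hC0, hC⟩ := h ‖t‖ (norm_nonneg t)
    have hcs : CauchySeq (fun n => f (n + N0) t) := by
      apply cauchySeq_of_le_tendsto_0' (fun n => C * q ^ (2 * (n + N0)))
      · intro n m hnm
        rw [dist_eq_norm]
        exact hC _ _ (by omega) (by omega) t le_rfl
      · have := (hq2.comp (Filter.tendsto_add_atTop_nat N0)).const_mul C
        simpa using this
    obtain ⟨y, hy⟩ := cauchySeq_tendsto_of_complete hcs
    exact ⟨y, (Filter.tendsto_add_atTop_iff_nat (f := fun N => f N t) N0).1 hy⟩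
  choose ψ hψ using hlim
  have hbd : ∀ T : ℝ, 0 ≤ T → ∃ C : ℝ, 0 < C ∧ ∀ N, N0 ≤ N →
      ∀ t : ℂ, ‖t‖ ≤ T → ‖f N t - ψ t‖ ≤ C * q ^ (2 * N) := by
    intro T hT
    obtain ⟨C, hC0, hC⟩ := h T hT
    refine ⟨C, hC0, ?_⟩
    intro N hN t ht
    have h1 : Filter.Tendsto (fun M => ‖f N t - f M t‖) Filter.atTop (nhds ‖f N t - ψ t‖) :=
      ((tendsto_const_nhds).sub (hψ t)).norm
    apply le_of_tendsto h1
    filter_upwards [Filter.eventually_ge_atTop N] with M hM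
    exact hC N M hN hM t ht
  refine ⟨ψ, ?_, hbd⟩
  have hloc : TendstoLocallyUniformlyOn f ψ Filter.atTop Set.univ := by
    rw [Metric.tendstoLocallyUniformlyOn_iff]
    intro ε hε x _
    refine ⟨Metric.ball x 1, mem_nhdsWithin_of_mem_nhds (Metric.ball_mem_nhds x one_pos), ?_⟩
    obtain ⟨C, hC0, hC⟩ := hbd (‖x‖ + 1) (by positivity)
    have h2 : Filter.Tendsto (fun N : ℕ => C * q ^ (2 * N)) Filter.atTop (nhds 0) := by
      simpa using hq2.const_mul C
    filter_upwards [Filter.eventually_ge_atTop N0, h2.eventually_lt_const hε] with N hN hlt y hy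
    rw [dist_comm, dist_eq_norm]
    refine (hC N hN y ?_).trans_lt hlt
    rw [Metric.mem_ball, dist_eq_norm] at hy
    have := norm_add_le x (y - x)
    rw [add_sub_cancel] at this
    linarith
  rw [← differentiableOn_univ]
  exact hloc.differentiableOn (Filter.Eventually.of_forall fun N => (hf N).differentiableOn) isOpen_univ

end QL


namespace QL

noncomputable def EP (q : ℝ) (N : ℕ) : ℂ[X] :=
  ∏ i ∈ Finset.range N, (1 - C ((q : ℂ) ^ (2 * (i + 1))) * X ^ 2)
noncomputable def LP (q : ℝ) (N : ℕ) (j : ℕ × Bool) : ℂ[X] :=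
  C (-(sg j.2 * (q : ℂ) ^ (j.1 + 1))) * (1 + C (sg j.2 * (q : ℂ) ^ (j.1 + 1)) * X) *
    ∏ i ∈ (Finset.range N).erase j.1, (1 - C ((q : ℂ) ^ (2 * (i + 1))) * X ^ 2)

lemma eval_EP (q : ℝ) (N : ℕ) (t : ℂ) : (EP q N).eval t = EE q N t := by
  simp [EP, EE, eval_prod]

lemma eval_LP (q : ℝ) (N : ℕ) (j : ℕ × Bool) (t : ℂ) : (LP q N j).eval t = LL q N j t := by
  simp only [LP, LL, eval_prod, eval_mul, eval_sub, eval_add, eval_C, eval_X, eval_one, eval_pow]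

lemma EP_deg {q : ℝ} (hq0 : 0 < q) (N : ℕ) :
    (EP q N).natDegree = 2 * N ∧ (EP q N).leadingCoeff = (-1) ^ N * (q : ℂ) ^ (N * (N + 1)) := by
  have hq : (q : ℂ) ≠ 0 := by exact_mod_cast hq0.ne'
  induction N with
  | zero => simp [EP]
  | succ n ih =>
    have e : EP q (n + 1) = EP q n * (C (-(q : ℂ) ^ (2 * (n + 1))) * X ^ 2 + C 0 * X + C 1) := by
      rw [EP, Finset.prod_range_succ, ← EP]
      congr 1
      simp
      ring
    have hne : -(q : ℂ) ^ (2 * (n + 1)) ≠ 0 := neg_ne_zero.2 (pow_ne_zero _ hq)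
    have d2 := natDegree_quadratic (b := (0 : ℂ)) (c := 1) hne
    have l2 := leadingCoeff_quadratic (b := (0 : ℂ)) (c := 1) hne
    have hE : EP q n ≠ 0 := by
      intro h0
      rw [h0, leadingCoeff_zero] at ih
      exact (mul_ne_zero (pow_ne_zero _ (by norm_num)) (pow_ne_zero _ hq)) ih.2.symm
    have hQ : (C (-(q : ℂ) ^ (2 * (n + 1))) * X ^ 2 + C 0 * X + C 1 : ℂ[X]) ≠ 0 := by
      intro h0
      rw [h0] at d2
      simp at d2
    rw [e]
    refine ⟨?_, ?_⟩
    · rw [natDegree_mul hE hQ, ih.1, d2]; ring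
    · rw [leadingCoeff_mul, ih.2, l2]; ring

lemma sg_q_xi {q : ℝ} (hq0 : 0 < q) (j : ℕ × Bool) : sg j.2 * (q : ℂ) ^ (j.1 + 1) * xi q j = 1 := by
  have hq : (q : ℂ) ≠ 0 := by exact_mod_cast hq0.ne'
  rw [xi]
  calc _ = (sg j.2 * sg j.2) * ((q : ℂ) ^ (j.1 + 1) * ((q : ℂ)⁻¹) ^ (j.1 + 1)) := by ring
    _ = 1 := by rw [sg_mul, ← mul_pow, mul_inv_cancel₀ hq]; simp

lemma xi_mul_LP {q : ℝ} (hq0 : 0 < q) (N : ℕ) (j : ℕ × Bool) (hj : j ∈ JJ N) :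
    (X - C (xi q j)) * LP q N j = EP q N := by
  rw [EP, ← Finset.mul_prod_erase _ _ (Finset.mem_range.2 (mem_JJ.1 hj)), LP, ← mul_assoc]
  congr 1
  have h1 : (C (sg j.2 * (q : ℂ) ^ (j.1 + 1)) : ℂ[X]) * C (xi q j) = 1 := by
    rw [← C_mul, sg_q_xi hq0, C_1]
  have h2 : (C ((q : ℂ) ^ (2 * (j.1 + 1))) : ℂ[X]) = C (sg j.2 * (q : ℂ) ^ (j.1 + 1)) ^ 2 := by
    rw [← C_pow, mul_pow, sg_sq, one_mul, ← pow_mul, mul_comm 2]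
  rw [h2, C_neg]
  linear_combination (1 + C (sg j.2 * (q : ℂ) ^ (j.1 + 1)) * X) * h1

lemma LP_deg {q : ℝ} (hq0 : 0 < q) (N : ℕ) (j : ℕ × Bool) (hj : j ∈ JJ N) :
    (LP q N j).natDegree + 1 = 2 * N ∧
    (LP q N j).leadingCoeff = (-1) ^ N * (q : ℂ) ^ (N * (N + 1)) := by
  have hq : (q : ℂ) ≠ 0 := by exact_mod_cast hq0.ne'
  obtain ⟨h1, h2⟩ := EP_deg hq0 N
  rw [← xi_mul_LP hq0 N j hj] at h1 h2
  rw [leadingCoeff_mul, leadingCoeff_X_sub_C, one_mul] at h2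
  have hne : LP q N j ≠ 0 := by
    intro h0
    rw [h0, leadingCoeff_zero] at h2
    exact (mul_ne_zero (pow_ne_zero _ (by norm_num)) (pow_ne_zero _ hq)) h2.symm
  rw [natDegree_mul (X_sub_C_ne_zero _) hne, natDegree_X_sub_C] at h1
  exact ⟨by omega, h2⟩

lemma EE_xi {q : ℝ} (hq0 : 0 < q) (N : ℕ) (j : ℕ × Bool) (hj : j ∈ JJ N) : EE q N (xi q j) = 0 := by
  rw [← eval_EP, ← xi_mul_LP hq0 N j hj]
  simp

lemma LL_xi_ne {q : ℝ} (hq0 : 0 < q) (N : ℕ) (i j : ℕ × Bool) (hi : i ∈ JJ N)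
    (hij : i ≠ j) : LL q N j (xi q i) = 0 := by
  have h1 := sg_q_xi hq0 i
  by_cases h : i.1 = j.1
  · have h2 : i.2 ≠ j.2 := fun h' => hij (Prod.ext h h')
    have h3 : sg j.2 = - sg i.2 := by
      revert h2
      cases i.2 <;> cases j.2 <;> simp [sg]
    have h4 : 1 + sg j.2 * (q : ℂ) ^ (j.1 + 1) * xi q i = 0 := by
      rw [h3, ← h]
      linear_combination -h1
    rw [LL, h4]
    simp
  · rw [LL]
    have : ∏ l ∈ (Finset.range N).erase j.1, (1 - (q : ℂ) ^ (2 * (l + 1)) * xi q i ^ 2) = 0 := by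
      apply Finset.prod_eq_zero (i := i.1) (Finset.mem_erase.2 ⟨h, Finset.mem_range.2 (mem_JJ.1 hi)⟩)
      have : (q : ℂ) ^ (2 * (i.1 + 1)) * xi q i ^ 2 = (sg i.2 * (q : ℂ) ^ (i.1 + 1) * xi q i) ^ 2 := by
        rw [mul_pow, mul_pow, sg_sq, one_mul, ← pow_mul, mul_comm 2]
      rw [this, h1]
      simp
    rw [this, mul_zero]

lemma LL_xi_self {q : ℝ} (hq0 : 0 < q) (hq1 : q < 1) (N : ℕ) (j : ℕ × Bool) (hj : j ∈ JJ N) :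
    LL q N j (xi q j) ≠ 0 := by
  rw [LL_xi hq0]
  have := dd_ne hq0 hq1 N j.1 (mem_JJ.1 hj)
  have h2 : sg j.2 ≠ 0 := by rw [← norm_ne_zero_iff, norm_sg]; norm_num
  exact mul_ne_zero (neg_ne_zero.2 h2) (by exact_mod_cast this)

lemma interp {q : ℝ} (hq0 : 0 < q) (hq1 : q < 1) (N : ℕ) (h : ℂ) (p : ℂ[X])
    (hdeg : (p - C h * EP q N).degree < ((2 * N : ℕ) : WithBot ℕ)) (a : ℕ × Bool → ℂ)
    (ha : ∀ j ∈ JJ N, a j = p.eval (xi q j) / LL q N j (xi q j)) (t : ℂ) :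
    FF q N h a t = p.eval t := by
  have hcard : (JJ N).card = 2 * N := by simp [JJ, mul_comm]
  have hkey : p - C h * EP q N = ∑ j ∈ JJ N, C (a j) * LP q N j := by
    apply Polynomial.eq_of_degrees_lt_of_eval_index_eq (v := xi q) (JJ N)
    · intro i hi j hj hij
      by_contra hne
      apply LL_xi_self hq0 hq1 N j hj
      have := LL_xi_ne hq0 N i j hi hne
      rwa [hij] at this
    · rw [hcard]; exact hdeg
    · rw [hcard]
      refine lt_of_le_of_lt (degree_sum_le _ _) ?_
      rw [Finset.sup_lt_iff (WithBot.bot_lt_coe _)]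
      intro j hj
      have h1 := (LP_deg hq0 N j hj).1
      have h2 := natDegree_C_mul_le (a j) (LP q N j)
      refine lt_of_le_of_lt degree_le_natDegree ?_
      exact_mod_cast (by omega : (C (a j) * LP q N j).natDegree < 2 * N)
    · intro i hi
      rw [eval_sub, eval_mul, eval_C, eval_EP, EE_xi hq0 N i hi, mul_zero, sub_zero, eval_finsetSum,
        Finset.sum_eq_single i]
      · rw [eval_mul, eval_C, eval_LP, ha i hi, div_mul_cancel₀ _ (LL_xi_self hq0 hq1 N i hi)]
      · intro j _ hji
        rw [eval_mul, eval_C, eval_LP, LL_xi_ne hq0 N i j hi hji.symm, mul_zero]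
      · intro hn; exact absurd hi hn
  have : p = C h * EP q N + ∑ j ∈ JJ N, C (a j) * LP q N j := by rw [← hkey]; ring
  rw [this, FF, eval_add, eval_mul, eval_C, eval_EP, eval_finsetSum]
  simp only [eval_mul, eval_C, eval_LP]

lemma sys_of_poly {q β : ℝ} (hq0 : 0 < q) (hq1 : q < 1) (hβ0 : 0 < β)
    (v : ℕ → Bool → ℂ) (N : ℕ) (h κ : ℂ) (p : ℂ[X])
    (hdeg : (p - C h * EP q N).degree < ((2 * N : ℕ) : WithBot ℕ))
    (hsum : ∀ j ∈ JJ N, HasSum (fun k : ℕ => ∑ b : Bool,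
      (p.eval (sg b * (q : ℂ) ^ k * ((q : ℂ)⁻¹) ^ N) *
        LL q N j (sg b * (q : ℂ) ^ k * ((q : ℂ)⁻¹) ^ N)) * v k b * ((β : ℂ) ^ k * ((β : ℂ)⁻¹) ^ N)) κ) :
    ∃ a, Sys q β v N h κ a ∧ ∀ t, FF q N h a t = p.eval t := by
  classical
  have hq : (q : ℂ) ≠ 0 := by exact_mod_cast hq0.ne'
  have hβ : (β : ℂ) ≠ 0 := by exact_mod_cast hβ0.ne'
  obtain ⟨a, ha⟩ : ∃ a : ℕ × Bool → ℂ, ∀ j, a j = if j ∈ JJ N then p.eval (xi q j) / LL q N j (xi q j) else 0 :=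
    ⟨_, fun j => rfl⟩
  have hF := interp hq0 hq1 N h p hdeg a (fun j hj => by rw [ha, if_pos hj])
  refine ⟨a, ⟨fun j hj => by rw [ha, if_neg hj], ?_⟩, hF⟩
  intro j hj
  have hs := (hasSum_nat_add_iff' N).2 (hsum j hj)
  have hjN := mem_JJ.1 hj
  have e1 : Lam β q (fun k b => v (N + k) b) (fun t => FF q N h a t * LL q N j t) =
      ∑' k : ℕ, ∑ b : Bool, (p.eval (sg b * (q : ℂ) ^ (k + N) * ((q : ℂ)⁻¹) ^ N) *
        LL q N j (sg b * (q : ℂ) ^ (k + N) * ((q : ℂ)⁻¹) ^ N)) * v (k + N) b *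
          ((β : ℂ) ^ (k + N) * ((β : ℂ)⁻¹) ^ N) := by
    rw [Lam]
    congr 1
    ext k
    apply Finset.sum_congr rfl
    intro b _
    have z1 : sg b * (q : ℂ) ^ (k + N) * ((q : ℂ)⁻¹) ^ N = eta q k b := by
      rw [eta, pow_add, inv_pow]
      field_simp
    have z2 : (β : ℂ) ^ (k + N) * ((β : ℂ)⁻¹) ^ N = (β : ℂ) ^ k := by
      rw [pow_add, inv_pow]
      field_simp
    rw [z1, z2, hF, add_comm N k]
  rw [e1, hs.tsum_eq]
  have e2 : ∑ k ∈ Finset.range N, ∑ b : Bool,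
      (p.eval (sg b * (q : ℂ) ^ k * ((q : ℂ)⁻¹) ^ N) *
        LL q N j (sg b * (q : ℂ) ^ k * ((q : ℂ)⁻¹) ^ N)) * v k b * ((β : ℂ) ^ k * ((β : ℂ)⁻¹) ^ N) =
      p.eval (xi q j) * LL q N j (xi q j) * v (N - (j.1 + 1)) j.2 * ((β : ℂ)⁻¹) ^ (j.1 + 1) := by
    have z1 : ∀ k, k < N → ∀ b, sg b * (q : ℂ) ^ k * ((q : ℂ)⁻¹) ^ N = xi q (N - 1 - k, b) := by
      intro k hk b
      rw [xi]
      have : N = k + ((N - 1 - k) + 1) := by omega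
      have h2 : ((q : ℂ)⁻¹) ^ N = ((q : ℂ)⁻¹) ^ k * ((q : ℂ)⁻¹) ^ ((N - 1 - k) + 1) := by
        rw [← pow_add, ← this]
      rw [h2]
      have h3 : (q : ℂ) ^ k * ((q : ℂ)⁻¹) ^ k = 1 := by rw [← mul_pow, mul_inv_cancel₀ hq, one_pow]
      linear_combination (sg b * ((q : ℂ)⁻¹) ^ ((N - 1 - k) + 1)) * h3
    rw [Finset.sum_eq_single (N - (j.1 + 1))]
    · have hk : N - 1 - (N - (j.1 + 1)) = j.1 := by omega
      rw [Finset.sum_eq_single j.2]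
      · rw [z1 _ (by omega), hk]
        have h2 : ((β : ℂ)⁻¹) ^ N = ((β : ℂ)⁻¹) ^ (N - (j.1 + 1)) * ((β : ℂ)⁻¹) ^ (j.1 + 1) := by
          rw [← pow_add]; congr 1; omega
        have h3 : (β : ℂ) ^ (N - (j.1 + 1)) * ((β : ℂ)⁻¹) ^ (N - (j.1 + 1)) = 1 := by
          rw [← mul_pow, mul_inv_cancel₀ hβ, one_pow]
        rw [h2, ← mul_assoc ((β : ℂ) ^ _), h3, one_mul]
      · intro b _ hb
        rw [z1 _ (by omega), hk, LL_xi_ne hq0 N (j.1, b) j (mem_JJ.2 hjN), mul_zero, zero_mul, zero_mul]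
        intro hh
        exact hb (by rw [← hh])
      · intro hn; exact absurd (Finset.mem_univ _) hn
    · intro k hk hkne
      have hkN := Finset.mem_range.1 hk
      apply Finset.sum_eq_zero
      intro b _
      rw [z1 k hkN, LL_xi_ne hq0 N (N - 1 - k, b) j (mem_JJ.2 (by simp only; omega)), mul_zero, zero_mul, zero_mul]
      intro hh
      apply hkne
      rw [← hh]
      simp only
      omega
    · intro hn
      exact absurd (Finset.mem_range.2 (by omega)) hn
  rw [e2]
  have hL := LL_xi_self hq0 hq1 N j hj
  have hee : (ee q β N j.1 : ℂ) = (β : ℂ) ^ (j.1 + 1) / LL q N j (xi q j) ^ 2 := by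
    rw [LL_xi hq0, ee]
    push_cast
    rw [mul_pow, neg_sq, sg_sq, one_mul]
  have e3 : a j / (ee q β N j.1 : ℂ) = p.eval (xi q j) * LL q N j (xi q j) * ((β : ℂ)⁻¹) ^ (j.1 + 1) := by
    rw [hee, ha, if_pos hj, inv_pow]
    have := pow_ne_zero (j.1 + 1) hβ
    field_simp
  rw [e3]
  ring

end QL

namespace QL

lemma hasSum_of_eq {f g : ℕ → ℂ} {a : ℂ} (h : ∀ k, f k = g k) (H : HasSum g a) : HasSum f a := by
  rwa [funext h]

lemma orth {q β : ℝ} (v : ℕ → Bool → ℂ) (P : ℕ → ℂ[X]) (hmonic : ∀ n, (P n).Monic)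
    (hdeg : ∀ n, (P n).natDegree = n) (γ : ℕ → ℂ)
    (horth : ∀ n m : ℕ, HasSum (fun k : ℕ => ∑ b : Bool,
      ((P n).eval (sg b * (q : ℂ) ^ k) * (P m).eval (sg b * (q : ℂ) ^ k)) * v k b * (β : ℂ) ^ k)
      (if n = m then γ n else 0)) (n : ℕ) (d : ℕ) : d ≤ n + 1 → ∀ r : ℂ[X],
      r.degree < (d : WithBot ℕ) → HasSum (fun k : ℕ => ∑ b : Bool,
      ((P n).eval (sg b * (q : ℂ) ^ k) * r.eval (sg b * (q : ℂ) ^ k)) * v k b * (β : ℂ) ^ k)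
      (r.coeff n * γ n) := by
  induction d with
  | zero =>
    intro _ r hr
    have : r = 0 := by
      rw [← degree_eq_bot]
      exact Nat.WithBot.lt_zero_iff.1 (by simpa using hr)
    subst this
    simp
  | succ d ih =>
    intro hd r hr
    set r' := r - C (r.coeff d) * P d with hr'
    have hPd : (P d).coeff d = 1 := by
      have := hmonic d
      rwa [Monic, leadingCoeff, hdeg] at this
    have hlt : r'.degree < (d : WithBot ℕ) := by
      rw [degree_lt_iff_coeff_zero]
      intro m hm
      rw [hr', coeff_sub, coeff_C_mul]
      rcases Nat.eq_or_lt_of_le hm with h | h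
      · subst h; rw [hPd]; ring
      · rw [coeff_eq_zero_of_degree_lt (lt_of_lt_of_le hr (by exact_mod_cast h)),
          coeff_eq_zero_of_natDegree_lt (p := P d) (by rw [hdeg]; exact h)]
        ring
    have h1 := ih (by omega) r' hlt
    have h2 := (horth n d).mul_left (r.coeff d)
    have h3 := h1.add h2
    have hv : r'.coeff n * γ n + r.coeff d * (if n = d then γ n else 0) = r.coeff n * γ n := by
      rw [coeff_eq_zero_of_degree_lt (lt_of_lt_of_le hlt (by exact_mod_cast (by omega : d ≤ n)))]
      by_cases h : n = d
      · subst h; simp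
      · rw [if_neg h, coeff_eq_zero_of_degree_lt (p := r) (n := n) (lt_of_lt_of_le hr
          (by exact_mod_cast (by omega : d + 1 ≤ n)))]
        ring
    rw [hv] at h3
    refine hasSum_of_eq (fun k => ?_) h3
    rw [Finset.mul_sum, ← Finset.sum_add_distrib]
    refine Finset.sum_congr rfl fun b _ => ?_
    rw [hr', eval_sub, eval_mul, eval_C]
    ring

lemma family {q β : ℝ} (hq0 : 0 < q) (hq1 : q < 1) (hβ0 : 0 < β)
    (v : ℕ → Bool → ℂ) (P : ℕ → ℂ[X]) (hmonic : ∀ n, (P n).Monic)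
    (hdeg : ∀ n, (P n).natDegree = n) (γ : ℕ → ℂ)
    (horth : ∀ n m : ℕ, HasSum (fun k : ℕ => ∑ b : Bool,
      ((P n).eval (sg b * (q : ℂ) ^ k) * (P m).eval (sg b * (q : ℂ) ^ k)) * v k b * (β : ℂ) ^ k)
      (if n = m then γ n else 0)) (n N : ℕ) (hn : 2 * N ≤ n + 1) (A h κ : ℂ)
    (hd : (C A * (P n).comp (C ((q : ℂ) ^ N) * X) - C h * EP q N).degree < ((2 * N : ℕ) : WithBot ℕ))
    (hκ : ∀ j ∈ JJ N, A * ((β : ℂ)⁻¹) ^ N * ((LP q N j).coeff n * (((q : ℂ)⁻¹) ^ N) ^ n * γ n) = κ) :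
    ∃ a, Sys q β v N h κ a ∧ ∀ t, FF q N h a t = A * (P n).eval ((q : ℂ) ^ N * t) := by
  have hq : (q : ℂ) ≠ 0 := by exact_mod_cast hq0.ne'
  have hE : ∀ t, (C A * (P n).comp (C ((q : ℂ) ^ N) * X)).eval t = A * (P n).eval ((q : ℂ) ^ N * t) := by
    intro t; simp
  obtain ⟨a, ha, ha'⟩ := sys_of_poly hq0 hq1 hβ0 v N h κ _ hd (by
    intro j hj
    have hl := (LP_deg hq0 N j hj).1
    have hrd : ((LP q N j).comp (C (((q : ℂ)⁻¹) ^ N) * X)).degree < ((n + 1 : ℕ) : WithBot ℕ) := by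
      refine lt_of_le_of_lt degree_le_natDegree ?_
      have h1 := natDegree_comp_le (p := LP q N j) (q := C (((q : ℂ)⁻¹) ^ N) * X)
      have h2 : (C (((q : ℂ)⁻¹) ^ N) * X).natDegree ≤ 1 := (natDegree_C_mul_le _ _).trans natDegree_X_le
      have h3 := Nat.mul_le_mul_left (LP q N j).natDegree h2
      exact_mod_cast (by omega : ((LP q N j).comp (C (((q : ℂ)⁻¹) ^ N) * X)).natDegree < n + 1)
    have h1 := (orth v P hmonic hdeg γ horth n (n + 1) le_rfl _ hrd).mul_left (A * ((β : ℂ)⁻¹) ^ N)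
    rw [comp_C_mul_X_coeff, hκ j hj] at h1
    refine hasSum_of_eq (fun k => ?_) h1
    rw [Finset.mul_sum]
    refine Finset.sum_congr rfl fun b _ => ?_
    rw [hE, ← eval_LP, eval_comp, eval_mul, eval_C, eval_X]
    have e1 : (q : ℂ) ^ N * (sg b * (q : ℂ) ^ k * ((q : ℂ)⁻¹) ^ N) = sg b * (q : ℂ) ^ k := by
      rw [inv_pow]; field_simp
    rw [e1, mul_comm (((q : ℂ)⁻¹) ^ N) (sg b * (q : ℂ) ^ k)]
    ring)
  exact ⟨a, ha, fun t => by rw [ha', hE]⟩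

lemma fam1 {q β : ℝ} (hq0 : 0 < q) (hq1 : q < 1) (hβ0 : 0 < β)
    (v : ℕ → Bool → ℂ) (P : ℕ → ℂ[X]) (hmonic : ∀ n, (P n).Monic)
    (hdeg : ∀ n, (P n).natDegree = n) (γ : ℕ → ℂ)
    (horth : ∀ n m : ℕ, HasSum (fun k : ℕ => ∑ b : Bool,
      ((P n).eval (sg b * (q : ℂ) ^ k) * (P m).eval (sg b * (q : ℂ) ^ k)) * v k b * (β : ℂ) ^ k)
      (if n = m then γ n else 0)) (N : ℕ) (A : ℂ)
    (hA : A * (q : ℂ) ^ (2 * N ^ 2) = (-1) ^ N * (q : ℂ) ^ (N * (N + 1))) :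
    ∃ a, Sys q β v N 1 0 a ∧ ∀ t, FF q N 1 a t = A * (P (2 * N)).eval ((q : ℂ) ^ N * t) := by
  refine family hq0 hq1 hβ0 v P hmonic hdeg γ horth (2 * N) N (by omega) A 1 0 ?_ ?_
  · rw [degree_lt_iff_coeff_zero]
    intro m hm
    have hE := EP_deg hq0 N
    rw [coeff_sub, coeff_C_mul, coeff_C_mul, comp_C_mul_X_coeff]
    rcases Nat.eq_or_lt_of_le hm with h | h
    · subst h
      have h1 : (P (2 * N)).coeff (2 * N) = 1 := by
        have := hmonic (2 * N)
        rwa [Monic, leadingCoeff, hdeg] at this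
      have h2 := hE.2
      rw [leadingCoeff, hE.1] at h2
      rw [h1, h2, ← hA]
      ring
    · rw [coeff_eq_zero_of_natDegree_lt (p := EP q N) (by omega),
        coeff_eq_zero_of_natDegree_lt (p := P (2 * N)) (by rw [hdeg]; omega)]
      ring
  · intro j hj
    have := (LP_deg hq0 N j hj).1
    rw [coeff_eq_zero_of_natDegree_lt (by omega)]
    ring

lemma fam2 {q β : ℝ} (hq0 : 0 < q) (hq1 : q < 1) (hβ0 : 0 < β)
    (v : ℕ → Bool → ℂ) (P : ℕ → ℂ[X]) (hmonic : ∀ n, (P n).Monic)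
    (hdeg : ∀ n, (P n).natDegree = n) (γ : ℕ → ℂ)
    (horth : ∀ n m : ℕ, HasSum (fun k : ℕ => ∑ b : Bool,
      ((P n).eval (sg b * (q : ℂ) ^ k) * (P m).eval (sg b * (q : ℂ) ^ k)) * v k b * (β : ℂ) ^ k)
      (if n = m then γ n else 0)) (N : ℕ) (hN : 1 ≤ N) (A : ℂ)
    (hA : A * (-1) ^ N * (q : ℂ) ^ (N * (N + 1)) * γ (2 * N - 1) =
      (β : ℂ) ^ N * (q : ℂ) ^ (N * (2 * N - 1))) :
    ∃ a, Sys q β v N 0 1 a ∧ ∀ t, FF q N 0 a t = A * (P (2 * N - 1)).eval ((q : ℂ) ^ N * t) := by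
  have hq : (q : ℂ) ≠ 0 := by exact_mod_cast hq0.ne'
  have hβ : (β : ℂ) ≠ 0 := by exact_mod_cast hβ0.ne'
  refine family hq0 hq1 hβ0 v P hmonic hdeg γ horth (2 * N - 1) N (by omega) A 0 1 ?_ ?_
  · rw [degree_lt_iff_coeff_zero]
    intro m hm
    rw [coeff_sub, coeff_C_mul, coeff_C_mul, comp_C_mul_X_coeff,
      coeff_eq_zero_of_natDegree_lt (p := P (2 * N - 1)) (by rw [hdeg]; omega)]
    ring
  · intro j hj
    have h1 := LP_deg hq0 N j hj
    have h2 := h1.2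
    rw [leadingCoeff, show (LP q N j).natDegree = 2 * N - 1 by omega] at h2
    rw [h2, ← pow_mul, inv_pow, inv_pow]
    field_simp
    linear_combination hA

lemma exists_bd {q : ℝ} (hq0 : 0 < q) (hq1 : q < 1) (v : ℕ → Bool → ℂ) (hvne : ∀ k b, v k b ≠ 0)
    (c : ℝ) (hc : 0 < c) (K : ℕ) (hv : ∀ k, K ≤ k → ∀ b, ‖v k b - 1‖ ≤ c * q ^ (2 * k)) :
    ∃ c', 0 ≤ c' ∧ (∀ k b, ‖v k b - 1‖ ≤ c' * q ^ (2 * k)) ∧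
      ∀ k b, ‖(v k b)⁻¹ - 1‖ ≤ c' * q ^ (2 * k) := by
  -- threshold beyond which `‖v‖ ≥ 1/2`
  have ht : Filter.Tendsto (fun k : ℕ => c * q ^ (2 * k)) Filter.atTop (nhds 0) := by
    have h1 := (tendsto_pow_atTop_nhds_zero_of_lt_one (by positivity : 0 ≤ q ^ 2)
      (by nlinarith : q ^ 2 < 1)).const_mul c
    simpa [pow_mul] using h1
  obtain ⟨K1, hK1⟩ := Filter.eventually_atTop.1 (ht.eventually (gt_mem_nhds (by norm_num : (0:ℝ) < 1/2)))
  set g : ℕ × Bool → ℝ := fun x => (‖v x.1 x.2 - 1‖ + ‖(v x.1 x.2)⁻¹ - 1‖) / q ^ (2 * x.1) with hg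
  have hg0 : ∀ x, 0 ≤ g x := fun x => by positivity
  set S := ∑ x ∈ (Finset.range (max K K1)) ×ˢ (Finset.univ : Finset Bool), g x with hS
  have hS0 : 0 ≤ S := Finset.sum_nonneg fun x _ => hg0 x
  have key : ∀ k b, ‖v k b - 1‖ ≤ (2 * c + S) * q ^ (2 * k) ∧
      ‖(v k b)⁻¹ - 1‖ ≤ (2 * c + S) * q ^ (2 * k) := by
    intro k b
    have hqk : 0 < q ^ (2 * k) := by positivity
    by_cases h : k < max K K1
    · have h1 : g (k, b) ≤ S := Finset.single_le_sum (fun x _ => hg0 x) (by simpa using h)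
      have h2 : ‖v k b - 1‖ + ‖(v k b)⁻¹ - 1‖ ≤ S * q ^ (2 * k) := by
        rwa [hg, div_le_iff₀ hqk] at h1
      have h3 := norm_nonneg (v k b - 1)
      have h4 := norm_nonneg ((v k b)⁻¹ - 1)
      have h5 : 0 ≤ 2 * c * q ^ (2 * k) := by positivity
      constructor <;> nlinarith
    · push Not at h
      have h1 := hv k (le_trans (le_max_left _ _) h) b
      have h2 := hK1 k (le_trans (le_max_right _ _) h)
      have h3 : 1 / 2 ≤ ‖v k b‖ := by
        have := norm_sub_norm_le (1 : ℂ) (1 - v k b)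
        rw [sub_sub_cancel, norm_one, norm_sub_rev] at this
        linarith
      have h4 : ‖(v k b)⁻¹ - 1‖ ≤ 2 * (c * q ^ (2 * k)) := by
        have : (v k b)⁻¹ - 1 = -(v k b - 1) / v k b := by
          field_simp [hvne k b]
          ring
        rw [this, norm_div, norm_neg, div_le_iff₀ (by linarith)]
        have h6 : 0 ≤ c * q ^ (2 * k) := by positivity
        nlinarith
      have h5 : 0 ≤ S * q ^ (2 * k) := by positivity
      have h6 : 0 ≤ c * q ^ (2 * k) := by positivity
      constructor <;> nlinarith
  exact ⟨2 * c + S, by positivity, fun k b => (key k b).1, fun k b => (key k b).2⟩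

lemma fam_limit {q β : ℝ} (hq0 : 0 < q) (hq1 : q < 1) (hβ0 : 0 < β) (hβ1 : β < 1)
    (v : ℕ → Bool → ℂ) (c : ℝ) (hc : 0 ≤ c) (hvne : ∀ k b, v k b ≠ 0)
    (hv : ∀ k b, ‖v k b - 1‖ ≤ c * q ^ (2 * k)) (hv' : ∀ k b, ‖(v k b)⁻¹ - 1‖ ≤ c * q ^ (2 * k))
    (h κ : ℂ) (f : ℕ → ℂ → ℂ) (hf : ∀ N, Differentiable ℂ (f N))
    (hsys : ∀ N, 1 ≤ N → ∃ a, Sys q β v N h κ a ∧ ∀ t, FF q N h a t = f N t) :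
    ∃ ψ : ℂ → ℂ, Differentiable ℂ ψ ∧ ∃ N0 : ℕ, ∀ T, 0 ≤ T → ∃ C, 0 < C ∧ ∀ N, N0 ≤ N →
      ∀ t, ‖t‖ ≤ T → ‖f N t - ψ t‖ ≤ C * q ^ (2 * N) := by
  obtain ⟨N0, hN0⟩ := sys_cauchy hq0 hq1 hβ0 hβ1 v c hc hvne hv hv' h κ
  obtain ⟨ψ, h1, h2⟩ := limit_entire hq0 hq1 f hf (max N0 1) (by
    intro T hT
    obtain ⟨C, hC, hC'⟩ := hN0 T hT
    refine ⟨C, hC, fun N M hN hM t ht => ?_⟩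
    have hN1 : N0 ≤ N := le_trans (le_max_left _ _) hN
    have hN2 : 1 ≤ N := le_trans (le_max_right _ _) hN
    obtain ⟨a, ha, ha'⟩ := hsys N hN2
    obtain ⟨a2, hb, hb'⟩ := hsys M (hN2.trans hM)
    rw [← ha', ← hb']
    exact hC' N M hN1 hM a a2 ha hb t ht)
  exact ⟨ψ, h1, max N0 1, h2⟩

end QL


/-- asymptotics of rescaled `P_n` near the smallest zeros. -/
theorem statement0
    (q α : ℝ) (hq0 : 0 < q) (hq1 : q < 1) (hα : -1 < α)
    (r : ℝ) (hr1 : 1 < r) (hr2 : r < q⁻¹)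
    (w : ℂ → ℂ) (hw : AnalyticOn ℂ w (Metric.ball (0 : ℂ) r))
    (hwne : ∀ k : ℕ, w ((q : ℂ) ^ k) ≠ 0 ∧ w (-((q : ℂ) ^ k)) ≠ 0)
    (c : ℝ) (hc : 0 < c) (N₀ : ℕ)
    (hwnear : ∀ n : ℕ, n > N₀ →
      ‖1 - w (((Real.sqrt q ^ n : ℝ) : ℂ))‖ < c * q ^ n ∧
      ‖1 - w (-((Real.sqrt q ^ n : ℝ) : ℂ))‖ < c * q ^ n)
    (P : ℕ → Polynomial ℂ) (hmonic : ∀ n, (P n).Monic) (hdeg : ∀ n, (P n).natDegree = n)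
    (γ : ℕ → ℂ) (hγ : ∀ n, γ n ≠ 0)
    (horth : ∀ n m : ℕ, HasSum
      (fun k : ℕ =>
        ((P n).eval ((q : ℂ) ^ k) * (P m).eval ((q : ℂ) ^ k) * w ((q : ℂ) ^ k) +
          (P n).eval (-((q : ℂ) ^ k)) * (P m).eval (-((q : ℂ) ^ k)) * w (-((q : ℂ) ^ k))) *
        ((q ^ ((k : ℝ) * (1 + α)) : ℝ) : ℂ))
      (if n = m then γ n else 0)) :
    ∃ ψ φ : ℂ → ℂ, Differentiable ℂ ψ ∧ Differentiable ℂ φ ∧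
      ∀ m : ℕ, 0 < m → ∃ C : ℝ, 0 < C ∧ ∃ N : ℕ, ∀ n : ℕ, n > N → Even n →
        ∀ t : ℂ, ‖t‖ ≤ q ^ (-(m : ℝ) - 1 / 2) →
          ‖(-1 : ℂ) ^ (n / 2) *
              ((q ^ (-(((n / 2 : ℕ) : ℝ) * (((n / 2 : ℕ) : ℝ) - 1))) : ℝ) : ℂ) *
              (P n).eval (((q ^ ((n : ℝ) / 2) : ℝ) : ℂ) * t) - ψ t‖ < C * q ^ n ∧
          ‖(-1 : ℂ) ^ (n / 2) *
              ((q ^ ((((n / 2 : ℕ) : ℝ)) * (((n / 2 : ℕ) : ℝ) - 1 + α)) : ℝ) : ℂ) *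
              (γ (n - 1))⁻¹ *
              (P (n - 1)).eval (((q ^ ((n : ℝ) / 2) : ℝ) : ℂ) * t) - φ t‖ < C * q ^ n := by
  have hqc : (q : ℂ) ≠ 0 := by exact_mod_cast hq0.ne'
  set β : ℝ := q ^ (1 + α) with hβ
  have hβ0 : 0 < β := Real.rpow_pos_of_pos hq0 _
  have hβ1 : β < 1 := Real.rpow_lt_one hq0.le hq1 (by linarith)
  have hβk : ∀ k : ℕ, q ^ ((k : ℝ) * (1 + α)) = β ^ k := by
    intro k
    rw [hβ, ← Real.rpow_natCast, ← Real.rpow_mul hq0.le, mul_comm]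
  set v : ℕ → Bool → ℂ := fun k b => w (QL.sg b * (q : ℂ) ^ k) with hv
  have hst : QL.sg true = 1 := rfl
  have hsf : QL.sg false = -1 := rfl
  have hvt : ∀ k, v k true = w ((q : ℂ) ^ k) := by intro k; rw [hv]; simp [hst]
  have hvf : ∀ k, v k false = w (-(q : ℂ) ^ k) := by intro k; rw [hv]; simp [hsf]
  have hvne : ∀ k b, v k b ≠ 0 := by
    intro k b
    cases b
    · rw [hvf]; exact (hwne k).2
    · rw [hvt]; exact (hwne k).1
  obtain ⟨c', hc', hv1, hv2⟩ := QL.exists_bd hq0 hq1 v hvne c hc (N₀ + 1) (by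
    intro k hk b
    have h1 := hwnear (2 * k) (by omega)
    have h2 : ((Real.sqrt q ^ (2 * k) : ℝ) : ℂ) = (q : ℂ) ^ k := by
      rw [pow_mul, Real.sq_sqrt hq0.le]; push_cast; rfl
    rw [h2] at h1
    rw [norm_sub_rev]
    cases b
    · rw [hvf]; exact h1.2.le
    · rw [hvt]; exact h1.1.le)
  have horth' : ∀ n m : ℕ, HasSum (fun k : ℕ => ∑ b : Bool,
      ((P n).eval (QL.sg b * (q : ℂ) ^ k) * (P m).eval (QL.sg b * (q : ℂ) ^ k)) * v k b *
        (β : ℂ) ^ k) (if n = m then γ n else 0) := by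
    intro n m
    refine QL.hasSum_of_eq (fun k => ?_) (horth n m)
    rw [Fintype.sum_bool, hvt, hvf, hst, hsf, hβk k, one_mul, neg_one_mul]
    push_cast
    ring
  have hcast : ∀ k : ℕ, ((q ^ ((k : ℝ)) : ℝ) : ℂ) = (q : ℂ) ^ k := by
    intro k; rw [Real.rpow_natCast]; push_cast; rfl
  have hdf : ∀ (A : ℂ) (n N : ℕ), Differentiable ℂ (fun t => A * (P n).eval ((q : ℂ) ^ N * t)) := by
    intro A n N
    exact ((P n).differentiable.comp (differentiable_id.const_mul _)).const_mul A
  obtain ⟨ψ, hψ, N1, hψ'⟩ := QL.fam_limit hq0 hq1 hβ0 hβ1 v c' hc' hvne hv1 hv2 1 0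
    (fun N t => ((-1 : ℂ) ^ N * ((q ^ (-((N : ℝ) * ((N : ℝ) - 1))) : ℝ) : ℂ)) *
      (P (2 * N)).eval ((q : ℂ) ^ N * t)) (fun N => hdf _ _ _) (by
    intro N hN
    refine QL.fam1 hq0 hq1 hβ0 v P hmonic hdeg γ horth' N _ ?_
    rw [← hcast, ← hcast, mul_assoc, ← Complex.ofReal_mul, ← Real.rpow_add hq0]
    congr 4
    push_cast
    ring)
  obtain ⟨φ, hφ, N2, hφ'⟩ := QL.fam_limit hq0 hq1 hβ0 hβ1 v c' hc' hvne hv1 hv2 0 1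
    (fun N t => ((-1 : ℂ) ^ N * ((q ^ ((N : ℝ) * ((N : ℝ) - 1 + α)) : ℝ) : ℂ) *
      (γ (2 * N - 1))⁻¹) * (P (2 * N - 1)).eval ((q : ℂ) ^ N * t)) (fun N => hdf _ _ _) (by
    intro N hN
    refine QL.fam2 hq0 hq1 hβ0 v P hmonic hdeg γ horth' N hN _ ?_
    have e1 : (-1 : ℂ) ^ N * (-1) ^ N = 1 := by rw [← mul_pow]; simp
    have e2 : q ^ ((N : ℝ) * ((N : ℝ) - 1 + α)) * q ^ (N * (N + 1)) =
        β ^ N * q ^ (N * (2 * N - 1)) := by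
      rw [← hβk, ← Real.rpow_natCast q (N * (N + 1)), ← Real.rpow_natCast q (N * (2 * N - 1)),
        ← Real.rpow_add hq0, ← Real.rpow_add hq0]
      congr 1
      push_cast [Nat.cast_sub (show 1 ≤ 2 * N by omega)]
      ring
    have e3 : ((q ^ ((N : ℝ) * ((N : ℝ) - 1 + α)) : ℝ) : ℂ) * (q : ℂ) ^ (N * (N + 1)) =
        (β : ℂ) ^ N * (q : ℂ) ^ (N * (2 * N - 1)) := by exact_mod_cast congrArg Complex.ofReal e2
    have e4 := inv_mul_cancel₀ (hγ (2 * N - 1))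
    calc _ = ((-1 : ℂ) ^ N * (-1) ^ N) * (((q ^ ((N : ℝ) * ((N : ℝ) - 1 + α)) : ℝ) : ℂ) *
          (q : ℂ) ^ (N * (N + 1))) * ((γ (2 * N - 1))⁻¹ * γ (2 * N - 1)) := by ring
      _ = _ := by rw [e1, e3, e4]; ring)
  refine ⟨ψ, φ, hψ, hφ, fun m _ => ?_⟩
  have hT : 0 ≤ q ^ (-(m : ℝ) - 1 / 2) := Real.rpow_nonneg hq0.le _
  obtain ⟨C1, hC1, hb1⟩ := hψ' _ hT
  obtain ⟨C2, hC2, hb2⟩ := hφ' _ hT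
  refine ⟨C1 + C2, by positivity, 2 * (N1 + N2), ?_⟩
  rintro n hn ⟨N, hN⟩ t ht
  obtain rfl : n = 2 * N := by omega
  have hdiv : 2 * N / 2 = N := by omega
  have hhalf : ((q ^ (((2 * N : ℕ) : ℝ) / 2) : ℝ) : ℂ) = (q : ℂ) ^ N := by
    rw [← hcast]; congr 2; push_cast; ring
  have hqn : 0 < q ^ (2 * N) := by positivity
  rw [hdiv, hhalf]
  have h1 := hb1 N (by omega) t ht
  have h2 := hb2 N (by omega) t ht
  constructor
  · exact lt_of_le_of_lt h1 (by nlinarith)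
  · exact lt_of_le_of_lt h2 (by nlinarith)
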